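/- Over 𝔽_q for q = 251, the intersection lattice of the 27-hyperplane arrangement A admits a realization which is free but not recursively free; hence the strict inclusion 'recursively free ⊊ free' also holds in positive characteristic. -/

import Mathlib

open Module Matrix
open scoped Classical

namespace Arrgt

variable {K : Type*} [Field K]

/-- A (central) hyperplane arrangement in `K^n`: a finite set of kernels of
nonzero linear forms. -/
structure Arrangement (K : Type*) [Field K] (n : ℕ) where
  hyperplanes : Finset (Submodule K (Fin n → K))
  isHyp : ∀ H ∈ hyperplanes, ∃ f : (Fin n → K) →ₗ[K] K, f ≠ 0 ∧ H = LinearMap.ker f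

/-- The deletion `A \ {H}`. -/
noncomputable def Arrangement.delete {n : ℕ} (A : Arrangement K n) (H : Submodule K (Fin n → K)) :
    Arrangement K n :=
  ⟨A.hyperplanes.erase H, fun H' hH' => A.isHyp H' (Finset.mem_of_mem_erase hH')⟩

/-- The empty arrangement of rank `n`. -/
def emptyArr (K : Type*) [Field K] (n : ℕ) : Arrangement K n := ⟨∅, by simp⟩

/-- The linear polynomial in `K[x_1,...,x_n]` attached to a linear form. -/
noncomputable def linPoly {n : ℕ} (f : (Fin n → K) →ₗ[K] K) : MvPolynomial (Fin n) K :=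
  ∑ i, MvPolynomial.C (f (Pi.single i 1)) * MvPolynomial.X i

/-- `Q` is a defining polynomial of the arrangement `A`: a product of linear forms
whose kernels are exactly the hyperplanes of `A`. -/
def IsDefiningPoly {n : ℕ} (A : Arrangement K n) (Q : MvPolynomial (Fin n) K) : Prop :=
  ∃ α : Submodule K (Fin n → K) → ((Fin n → K) →ₗ[K] K),
    (∀ H ∈ A.hyperplanes, α H ≠ 0 ∧ LinearMap.ker (α H) = H) ∧
    Q = ∏ H ∈ A.hyperplanes, linPoly (α H)

/-- Evaluation of a derivation at the polynomial `Q`, as a linear map. -/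
noncomputable def evalDer {n : ℕ} (Q : MvPolynomial (Fin n) K) :
    Derivation K (MvPolynomial (Fin n) K) (MvPolynomial (Fin n) K) →ₗ[MvPolynomial (Fin n) K]
      MvPolynomial (Fin n) K where
  toFun θ := θ Q
  map_add' _ _ := rfl
  map_smul' _ _ := rfl

/-- The module `D(A) = {θ : θ(Q) ∈ Q·S}` of `A`-derivations (for a chosen defining
polynomial `Q`). -/
noncomputable def DerModule {n : ℕ} (Q : MvPolynomial (Fin n) K) :
    Submodule (MvPolynomial (Fin n) K)
      (Derivation K (MvPolynomial (Fin n) K) (MvPolynomial (Fin n) K)) :=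
  Submodule.comap (evalDer Q) (Ideal.span {Q})

/-- `A` is a free arrangement: `D(A)` is a free module over `S = K[x_1,...,x_n]`. -/
def IsFree {n : ℕ} (A : Arrangement K n) : Prop :=
  ∃ Q, IsDefiningPoly A Q ∧ Module.Free (MvPolynomial (Fin n) K) (DerModule Q)

/-- A nonzero derivation is homogeneous of polynomial degree `p` if all its
coefficients are homogeneous of degree `p`. -/
def IsHomogeneousDer {n : ℕ}
    (θ : Derivation K (MvPolynomial (Fin n) K) (MvPolynomial (Fin n) K)) (p : ℕ) : Prop :=
  θ ≠ 0 ∧ ∀ i, (θ (MvPolynomial.X i)).IsHomogeneous p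

/-- `A` is free with exponents the multiset `e`: `D(A)` has a homogeneous basis whose
polynomial degrees form the multiset `e`. -/
def HasExponents {n : ℕ} (A : Arrangement K n) (e : Multiset ℕ) : Prop :=
  ∃ Q, IsDefiningPoly A Q ∧
    ∃ (l : List ℕ) (b : Basis (Fin l.length) (MvPolynomial (Fin n) K) (DerModule Q)),
      (l : Multiset ℕ) = e ∧ ∀ i : Fin l.length, IsHomogeneousDer ((b i : DerModule Q) :
        Derivation K (MvPolynomial (Fin n) K) (MvPolynomial (Fin n) K)) (l.get i)

/-- `B` is (a model, via a linear identification `H ≅ K^n`, of) the restriction `A^H`. -/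
def IsRestriction {n : ℕ} (A : Arrangement K (n + 1)) (H : Submodule K (Fin (n + 1) → K))
    (B : Arrangement K n) : Prop :=
  ∃ e : H ≃ₗ[K] (Fin n → K),
    B.hyperplanes = (A.hyperplanes.erase H).image
      (fun H' => Submodule.map (e : H →ₗ[K] (Fin n → K)) (H'.comap H.subtype))

variable (K) in
/-- The class of inductively free arrangements. -/
inductive InductivelyFree : {n : ℕ} → Arrangement K n → Prop
  | empty (n : ℕ) : InductivelyFree (emptyArr K n)
  | add {n : ℕ} (A : Arrangement K (n + 1)) (H : Submodule K (Fin (n + 1) → K))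
      (hH : H ∈ A.hyperplanes) (B : Arrangement K n) (hB : IsRestriction A H B)
      (e' e'' : Multiset ℕ)
      (h1 : InductivelyFree (A.delete H)) (h2 : InductivelyFree B)
      (h3 : HasExponents (A.delete H) e') (h4 : HasExponents B e'')
      (h5 : e'' ≤ e') : InductivelyFree A

variable (K) in
/-- The class of recursively free arrangements. -/
inductive RecursivelyFree : {n : ℕ} → Arrangement K n → Prop
  | empty (n : ℕ) : RecursivelyFree (emptyArr K n)
  | add {n : ℕ} (A : Arrangement K (n + 1)) (H : Submodule K (Fin (n + 1) → K))
      (hH : H ∈ A.hyperplanes) (B : Arrangement K n) (hB : IsRestriction A H B)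
      (e' e'' : Multiset ℕ)
      (h1 : RecursivelyFree (A.delete H)) (h2 : RecursivelyFree B)
      (h3 : HasExponents (A.delete H) e') (h4 : HasExponents B e'')
      (h5 : e'' ≤ e') : RecursivelyFree A
  | del {n : ℕ} (A : Arrangement K (n + 1)) (H : Submodule K (Fin (n + 1) → K))
      (hH : H ∈ A.hyperplanes) (B : Arrangement K n) (hB : IsRestriction A H B)
      (e e'' : Multiset ℕ)
      (h1 : RecursivelyFree A) (h2 : RecursivelyFree B)
      (h3 : HasExponents A e) (h4 : HasExponents B e'')
      (h5 : e'' ≤ e) : RecursivelyFree (A.delete H)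

/-- The intersection lattice of a set of hyperplanes: all intersections of finite
subsets (including the ambient space `⊤` as the empty intersection). -/
def setLattice {n : ℕ} (𝓐 : Set (Submodule K (Fin n → K))) : Set (Submodule K (Fin n → K)) :=
  {X | ∃ s : Finset (Submodule K (Fin n → K)), ↑s ⊆ 𝓐 ∧ X = s.inf id}

/-- The intersection lattice of an arrangement. -/
def Arrangement.lattice {n : ℕ} (A : Arrangement K n) : Set (Submodule K (Fin n → K)) :=
  setLattice (↑A.hyperplanes)

/-- The linear form `x ↦ ∑ v i * x i` attached to a normal vector `v`. -/
noncomputable def lf {n : ℕ} (v : Fin n → K) : (Fin n → K) →ₗ[K] K :=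
  ∑ i, v i • LinearMap.proj i

lemma lf_single {n : ℕ} (v : Fin n → K) (j : Fin n) : lf v (Pi.single j 1) = v j := by
  simp [lf, Pi.single_apply, mul_ite, Finset.sum_ite_eq']

lemma lf_ne_zero {n : ℕ} {v : Fin n → K} (hv : v ≠ 0) : lf v ≠ 0 := by
  intro h
  apply hv
  funext j
  have := congrArg (fun f : (Fin n → K) →ₗ[K] K => f (Pi.single j 1)) h
  simpa [lf_single] using this

/-- The hyperplane `v^⊥` with normal vector `v`. -/
noncomputable def perp {n : ℕ} (v : Fin n → K) : Submodule K (Fin n → K) :=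
  LinearMap.ker (lf v)

/-- Build an arrangement from a finite set of nonzero normal vectors. -/
noncomputable def mkArr {n : ℕ} (vs : Finset (Fin n → K)) (h : (0 : Fin n → K) ∉ vs) :
    Arrangement K n :=
  ⟨vs.image perp, by
    intro H hH
    obtain ⟨v, hv, rfl⟩ := Finset.mem_image.mp hH
    exact ⟨lf v, lf_ne_zero (fun h0 => h (h0 ▸ hv)), rfl⟩⟩

end Arrgt

instance : Fact (Nat.Prime 251) := ⟨by norm_num⟩

namespace Arrgt

open MvPolynomial

section LinearForms

variable {K : Type*} [Field K] {n : ℕ}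

lemma eval_linPoly (f : (Fin n → K) →ₗ[K] K) (x : Fin n → K) : eval x (linPoly f) = f x := by
  conv_rhs => rw [LinearMap.pi_apply_eq_sum_univ f x]
  simp only [linPoly, map_sum, map_mul, eval_C, eval_X, smul_eq_mul]
  refine Finset.sum_congr rfl fun i _ => ?_
  rw [mul_comm]
  congr 2
  ext j
  simp [Pi.single_apply, eq_comm]

lemma linPoly_isHomogeneous (f : (Fin n → K) →ₗ[K] K) : (linPoly f).IsHomogeneous 1 := by
  refine IsHomogeneous.sum _ _ _ fun i _ => ?_
  simpa using (isHomogeneous_C (Fin n) _).mul (isHomogeneous_X K i)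

lemma linPoly_smul (c : K) (f : (Fin n → K) →ₗ[K] K) : linPoly (c • f) = C c * linPoly f := by
  simp [linPoly, Finset.mul_sum, mul_assoc]

lemma exists_single_ne_zero {f : (Fin n → K) →ₗ[K] K} (hf : f ≠ 0) :
    ∃ i, f (Pi.single i 1) ≠ 0 := by
  by_contra! h
  refine hf (LinearMap.pi_ext' fun i => LinearMap.ext_ring ?_)
  simpa using h i

lemma linPoly_prime {f : (Fin n → K) →ₗ[K] K} (hf : f ≠ 0) : Prime (linPoly f) := by
  have key : linPoly f = sumSMulX (Finsupp.equivFunOnFinite.symm fun i => f (Pi.single i 1)) := by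
    rw [sumSMulX, Finsupp.linearCombination_apply, Finsupp.sum_fintype _ _ (by simp)]
    simp [linPoly, smul_eq_C_mul]
  obtain ⟨i, hi⟩ := exists_single_ne_zero hf
  rw [key]
  refine (irreducible_sumSMulX _ ⟨i, by simpa using hi⟩ fun r hr => ?_).prime
  have h1 := hr i
  simp only [Finsupp.equivFunOnFinite_symm_apply_apply] at h1
  refine IsUnit.mk0 r fun h0 => hi ?_
  rw [h0] at h1
  exact zero_dvd_iff.mp h1

lemma exists_eq_smul_of_ker_le {f g : (Fin n → K) →ₗ[K] K}
    (h : LinearMap.ker f ≤ LinearMap.ker g) : ∃ c : K, g = c • f := by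
  have := mem_span_of_iInf_ker_le_ker (ι := Unit) (L := fun _ => f) (K := g) (by simpa using h)
  obtain ⟨c, hc⟩ := Submodule.mem_span_singleton.mp (by simpa using this)
  exact ⟨c, hc.symm⟩

lemma ker_eq_ker_of_ker_le {f g : (Fin n → K) →ₗ[K] K} (hg : g ≠ 0)
    (h : LinearMap.ker f ≤ LinearMap.ker g) : LinearMap.ker f = LinearMap.ker g := by
  obtain ⟨c, rfl⟩ := exists_eq_smul_of_ker_le h
  have hc : c ≠ 0 := by rintro rfl; simp at hg
  exact (LinearMap.ker_smul f c hc).symm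

lemma ker_eq_of_linPoly_dvd {f g : (Fin n → K) →ₗ[K] K} (hg : g ≠ 0)
    (h : linPoly f ∣ linPoly g) : LinearMap.ker f = LinearMap.ker g := by
  refine ker_eq_ker_of_ker_le hg fun x hx => ?_
  obtain ⟨q, hq⟩ := h
  have := congrArg (eval x) hq
  rw [map_mul, eval_linPoly, eval_linPoly, LinearMap.mem_ker.mp hx, zero_mul] at this
  exact this

lemma linPoly_dvd_of_ker_eq {f g : (Fin n → K) →ₗ[K] K}
    (h : LinearMap.ker f = LinearMap.ker g) : linPoly g ∣ linPoly f := by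
  obtain ⟨c, rfl⟩ := exists_eq_smul_of_ker_le h.ge
  exact ⟨C c, by rw [linPoly_smul, mul_comm]⟩

lemma isRelPrime_linPoly {f g : (Fin n → K) →ₗ[K] K} (hf : f ≠ 0) (hg : g ≠ 0)
    (h : LinearMap.ker f ≠ LinearMap.ker g) : IsRelPrime (linPoly f) (linPoly g) :=
  (linPoly_prime hf).irreducible.isRelPrime_iff_not_dvd.mpr
    fun hd => h (ker_eq_of_linPoly_dvd hg hd)

end LinearForms

section DerivationModule

variable {K : Type*} [Field K] {n : ℕ}

local notation "S" => MvPolynomial (Fin n) K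
local notation "Dr" => Derivation K (MvPolynomial (Fin n) K) (MvPolynomial (Fin n) K)

lemma der_linPoly (θ : Dr) (f : (Fin n → K) →ₗ[K] K) :
    θ (linPoly f) = ∑ i, C (f (Pi.single i 1)) * θ (X i) := by
  simp [linPoly, map_sum]

lemma mem_DerModule {Q : S} {θ : Dr} : θ ∈ DerModule Q ↔ Q ∣ θ Q := by
  simp only [DerModule, Submodule.mem_comap, Ideal.mem_span_singleton]
  rfl

lemma exists_isDefiningPoly (A : Arrangement K n) : ∃ Q, IsDefiningPoly A Q := by
  have : ∀ H, ∃ f : (Fin n → K) →ₗ[K] K, H ∈ A.hyperplanes → f ≠ 0 ∧ LinearMap.ker f = H := by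
    intro H
    by_cases hH : H ∈ A.hyperplanes
    · obtain ⟨f, hf, h⟩ := A.isHyp H hH
      exact ⟨f, fun _ => ⟨hf, h.symm⟩⟩
    · exact ⟨0, fun h => absurd h hH⟩
  choose α hα using this
  exact ⟨_, α, hα, rfl⟩

lemma dvd_der_prod {ι : Type*} (s : Finset ι) (a : ι → S) (θ : Dr) (h : ∀ i ∈ s, a i ∣ θ (a i)) :
    ∏ i ∈ s, a i ∣ θ (∏ i ∈ s, a i) := by
  induction s using Finset.induction_on with
  | empty => simp
  | insert i s hi ih =>
    rw [Finset.prod_insert hi, Derivation.leibniz, smul_eq_mul, smul_eq_mul]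
    refine dvd_add (mul_dvd_mul_left _ (ih fun j hj => h j (Finset.mem_insert_of_mem hj))) ?_
    rw [mul_comm]
    exact mul_dvd_mul_left _ (h i (Finset.mem_insert_self _ _))

/-- The defining polynomial is divisible by a form exactly once. -/
lemma IsDefiningPoly.exists_eq_mul {A : Arrangement K n} {Q : S} (hQ : IsDefiningPoly A Q)
    {f : (Fin n → K) →ₗ[K] K} (hf : f ≠ 0) (hA : LinearMap.ker f ∈ A.hyperplanes) :
    ∃ R, Q = linPoly f * R ∧ ¬ linPoly f ∣ R := by
  obtain ⟨α, hα, rfl⟩ := hQ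
  obtain ⟨c, hc⟩ := exists_eq_smul_of_ker_le (hα _ hA).2.ge
  refine ⟨C c * ∏ H ∈ A.hyperplanes.erase (LinearMap.ker f), linPoly (α H), ?_, ?_⟩
  · rw [← Finset.mul_prod_erase _ _ hA]
    conv_lhs => rw [hc, linPoly_smul]
    ring
  · have hc0 : c ≠ 0 := by
      rintro rfl
      exact (hα _ hA).1 (by simpa using hc)
    rw [(linPoly_prime hf).dvd_mul]
    rintro (h | h)
    · refine (linPoly_prime hf).not_isUnit (isUnit_of_dvd_unit h ?_)
      exact (IsUnit.mk0 c hc0).map C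
    · obtain ⟨H, hH, hd⟩ := (Prime.dvd_finsetProd_iff (linPoly_prime hf) _).mp h
      rw [Finset.mem_erase] at hH
      exact hH.1 (((hα H hH.2).2.symm).trans (ker_eq_of_linPoly_dvd (hα H hH.2).1 hd).symm)

lemma IsDefiningPoly.mem_iff {A : Arrangement K n} {Q : S} (hQ : IsDefiningPoly A Q) {θ : Dr} :
    θ ∈ DerModule Q ↔ ∀ f : (Fin n → K) →ₗ[K] K, f ≠ 0 → LinearMap.ker f ∈ A.hyperplanes →
      linPoly f ∣ θ (linPoly f) := by
  rw [mem_DerModule]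
  constructor
  · intro h f hf hA
    obtain ⟨R, rfl, hR⟩ := hQ.exists_eq_mul hf hA
    rw [Derivation.leibniz, smul_eq_mul, smul_eq_mul] at h
    have h1 := (dvd_add_right (dvd_mul_right (linPoly f) (θ R))).mp
      ((dvd_mul_right (linPoly f) R).trans h)
    exact ((linPoly_prime hf).dvd_mul.mp h1).resolve_left hR
  · intro h
    obtain ⟨α, hα, rfl⟩ := hQ
    refine dvd_der_prod _ _ _ fun H hH => h _ (hα H hH).1 ?_
    rwa [(hα H hH).2]

lemma IsDefiningPoly.dvd_of_forall_dvd {A : Arrangement K n} {Q p : S} (hQ : IsDefiningPoly A Q)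
    (h : ∀ f : (Fin n → K) →ₗ[K] K, f ≠ 0 → LinearMap.ker f ∈ A.hyperplanes → linPoly f ∣ p) :
    Q ∣ p := by
  obtain ⟨α, hα, rfl⟩ := hQ
  refine Finset.prod_dvd_of_isRelPrime (fun H hH H' hH' hne => ?_) fun H hH => ?_
  · refine isRelPrime_linPoly (hα H hH).1 (hα H' hH').1 ?_
    rwa [(hα H hH).2, (hα H' hH').2]
  · exact h _ (hα H hH).1 (by rwa [(hα H hH).2])

lemma IsDefiningPoly.isHomogeneous {A : Arrangement K n} {Q : S} (hQ : IsDefiningPoly A Q) :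
    Q.IsHomogeneous A.hyperplanes.card := by
  obtain ⟨α, -, rfl⟩ := hQ
  simpa using IsHomogeneous.prod A.hyperplanes _ (fun _ => 1)
    fun H _ => linPoly_isHomogeneous (α H)

lemma IsDefiningPoly.ne_zero {A : Arrangement K n} {Q : S} (hQ : IsDefiningPoly A Q) : Q ≠ 0 := by
  obtain ⟨α, hα, rfl⟩ := hQ
  exact Finset.prod_ne_zero_iff.mpr fun H hH => (linPoly_prime (hα H hH).1).ne_zero

/-- One half of Saito's criterion: the coefficient determinant of logarithmic derivations is
divisible by the defining polynomial. -/
lemma IsDefiningPoly.dvd_det {A : Arrangement K n} {Q : S} (hQ : IsDefiningPoly A Q)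
    (θ : Fin n → Dr) (hθ : ∀ i, θ i ∈ DerModule Q) :
    Q ∣ (Matrix.of fun i j => θ i (X j)).det := by
  refine hQ.dvd_of_forall_dvd fun f hf hA => ?_
  have hprime := linPoly_prime hf
  have : (Ideal.span {linPoly f}).IsPrime :=
    (Ideal.span_singleton_prime hprime.ne_zero).mpr hprime
  rw [← Ideal.mem_span_singleton, ← Ideal.Quotient.eq_zero_iff_mem, RingHom.map_det,
    ← Matrix.exists_mulVec_eq_zero_iff]
  refine ⟨fun j => Ideal.Quotient.mk _ (C (f (Pi.single j 1))), fun h0 => ?_, ?_⟩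
  · obtain ⟨i, hi⟩ := exists_single_ne_zero hf
    have h1 := congrFun h0 i
    simp only [Pi.zero_apply] at h1
    rw [Ideal.Quotient.eq_zero_iff_mem, Ideal.mem_span_singleton] at h1
    exact hprime.not_isUnit (isUnit_of_dvd_unit h1 ((IsUnit.mk0 _ hi).map C))
  · ext i
    have h1 := hQ.mem_iff.mp (hθ i) f hf hA
    rw [← Ideal.mem_span_singleton, ← Ideal.Quotient.eq_zero_iff_mem, der_linPoly, map_sum] at h1
    rw [Pi.zero_apply, ← h1]
    simp [Matrix.mulVec, dotProduct, mul_comm]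

lemma der_eq_zero_iff {θ : Dr} : θ = 0 ↔ ∀ i, θ (X i) = 0 :=
  ⟨fun h i => by simp [h], fun h => derivation_ext fun i => by simp [h i]⟩

end DerivationModule

section Graded

variable {K : Type*} [Field K] {n : ℕ}

local notation "S" => MvPolynomial (Fin n) K
local notation "Dr" => Derivation K (MvPolynomial (Fin n) K) (MvPolynomial (Fin n) K)

lemma homogeneousComponent_mul_of_isHomogeneous (a : S) {p : S} {k : ℕ} (hp : p.IsHomogeneous k)
    (d : ℕ) : homogeneousComponent d (a * p) =
      if k ≤ d then homogeneousComponent (d - k) a * p else 0 := by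
  let := MvPolynomial.gradedAlgebra (σ := Fin n) (R := K)
  have := DirectSum.coe_decompose_mul_of_right_mem (homogeneousSubmodule (Fin n) K) (a := a) d
    (show p ∈ homogeneousSubmodule (Fin n) K k from hp)
  have h (q : S) (i : ℕ) : (DirectSum.decompose (homogeneousSubmodule (Fin n) K) q i : S) =
      homogeneousComponent i q := by
    change ((decomposition.decompose' q i : homogeneousSubmodule (Fin n) K i) : S) = _
    rw [decomposition.decompose'_apply]
  rwa [h, h] at this

lemma der_sum_apply {ι : Type*} (s : Finset ι) (a : ι → S) (θ : ι → Dr) (p : S) :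
    (∑ i ∈ s, a i • θ i) p = ∑ i ∈ s, a i * θ i p := by
  change evalDer p (∑ i ∈ s, a i • θ i) = _
  rw [map_sum]
  rfl

lemma basis_repr_eq {ι : Type*} [Fintype ι] {D : Submodule S Dr} (b : Basis ι S D) {l : ι → ℕ}
    (hb : ∀ i j, ((b i : Dr) (X j)).IsHomogeneous (l i)) {θ : D} {d : ℕ}
    (hθ : ∀ j, ((θ : Dr) (X j)).IsHomogeneous d) (i : ι) :
    b.repr θ i = if l i ≤ d then homogeneousComponent (d - l i) (b.repr θ i) else 0 := by
  set a : ι → S := fun i => if l i ≤ d then homogeneousComponent (d - l i) (b.repr θ i) else 0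
    with ha
  have key : θ = ∑ i, a i • b i := by
    refine Subtype.ext (derivation_ext fun j => ?_)
    have h1 : (θ : Dr) (X j) = ∑ i, b.repr θ i * (b i : Dr) (X j) := by
      conv_lhs => rw [← b.sum_repr θ]
      simp only [AddSubmonoidClass.coe_finsetSum, Submodule.coe_smul, der_sum_apply]
    have h2 := congrArg (homogeneousComponent d) h1
    rw [homogeneousComponent_eq_self (hθ j), map_sum] at h2
    rw [h2]
    simp only [AddSubmonoidClass.coe_finsetSum, Submodule.coe_smul, der_sum_apply]
    refine Finset.sum_congr rfl fun i _ => ?_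
    rw [homogeneousComponent_mul_of_isHomogeneous _ (hb i j)]
    by_cases h : l i ≤ d
    · rw [if_pos h, ha]
      simp only [if_pos h]
    · rw [if_neg h, ha]
      simp only [if_neg h, zero_mul]
  conv_lhs => rw [key, b.repr_sum_self]

lemma basis_repr_isHomogeneous {ι : Type*} [Fintype ι] {D : Submodule S Dr} (b : Basis ι S D)
    {l : ι → ℕ} (hb : ∀ i j, ((b i : Dr) (X j)).IsHomogeneous (l i)) {θ : D} {d : ℕ}
    (hθ : ∀ j, ((θ : Dr) (X j)).IsHomogeneous d) (i : ι) :
    (b.repr θ i).IsHomogeneous (d - l i) := by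
  rw [basis_repr_eq b hb hθ i]
  split_ifs
  · exact homogeneousComponent_isHomogeneous _ _
  · exact isHomogeneous_zero _ _ _

lemma basis_repr_eq_zero {ι : Type*} [Fintype ι] {D : Submodule S Dr} (b : Basis ι S D)
    {l : ι → ℕ} (hb : ∀ i j, ((b i : Dr) (X j)).IsHomogeneous (l i)) {θ : D} {d : ℕ}
    (hθ : ∀ j, ((θ : Dr) (X j)).IsHomogeneous d) {i : ι} (hi : d < l i) : b.repr θ i = 0 := by
  rw [basis_repr_eq b hb hθ i, if_neg (by omega)]

/-- A free graded module has at least as many generators of degree at most `d` as it has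
independent elements of degree at most `d`. -/
lemma le_card_degree_le {ι : Type*} [Fintype ι] {D : Submodule S Dr} (b : Basis ι S D)
    {l : ι → ℕ} (hb : ∀ i j, ((b i : Dr) (X j)).IsHomogeneous (l i)) {m d : ℕ} (v : Fin m → D)
    (hv : LinearIndependent S v)
    (hd : ∀ k, ∃ e ≤ d, ∀ j, ((v k : Dr) (X j)).IsHomogeneous e) :
    m ≤ (Finset.univ.filter fun i => l i ≤ d).card := by
  have hspan : Set.range v ≤ Submodule.span S
      (((Finset.univ.filter fun i => l i ≤ d).image b : Finset D) : Set D) := by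
    rintro _ ⟨k, rfl⟩
    obtain ⟨e, he, hom⟩ := hd k
    rw [SetLike.mem_coe, ← b.sum_repr (v k)]
    refine Submodule.sum_mem _ fun i _ => ?_
    by_cases hi : l i ≤ d
    · refine Submodule.smul_mem _ _ (Submodule.subset_span ?_)
      simp only [Finset.coe_image, Finset.coe_filter]
      exact ⟨i, by simpa using hi, rfl⟩
    · rw [basis_repr_eq_zero b hb hom (by omega), zero_smul]
      exact Submodule.zero_mem _
  have := linearIndependent_le_span' v hv _ hspan
  simp only [Finset.coe_sort_coe, Fintype.card_coe, Cardinal.mk_fin, Nat.cast_le] at this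
  exact this.trans Finset.card_image_le

lemma HasExponents.exists_basis {A : Arrangement K n} {e : Multiset ℕ} (h : HasExponents A e) :
    ∃ Q, IsDefiningPoly A Q ∧ ∃ (m : ℕ) (l : Fin m → ℕ) (b : Basis (Fin m) S (DerModule Q)),
      e = Finset.univ.val.map l ∧ ∀ i j, ((b i : Dr) (X j)).IsHomogeneous (l i) := by
  obtain ⟨Q, hQ, l, b, rfl, hb⟩ := h
  refine ⟨Q, hQ, l.length, l.get, b, ?_, fun i => (hb i).2⟩
  simp

end Graded

section Determinants

variable {K : Type*} [Field K] {n : ℕ}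

local notation "S" => MvPolynomial (Fin n) K
local notation "Dr" => Derivation K (MvPolynomial (Fin n) K) (MvPolynomial (Fin n) K)

lemma eq_zero_of_dvd_of_degree_lt {p q : S} {d k : ℕ} (hp : p.IsHomogeneous d)
    (hq : q.IsHomogeneous k) (h : q ∣ p) (hdk : d < k) : p = 0 := by
  by_contra h0
  have hq0 : q ≠ 0 := fun hq0 => h0 (zero_dvd_iff.mp (hq0 ▸ h))
  have := totalDegree_le_of_dvd_of_isDomain h h0
  rw [hp.totalDegree h0, hq.totalDegree hq0] at this
  omega

lemma exists_C_mul_of_dvd {p q : S} {d : ℕ} (hp : p.IsHomogeneous d) (hq : q.IsHomogeneous d)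
    (h : q ∣ p) : ∃ c : K, p = C c * q := by
  by_cases h0 : p = 0
  · exact ⟨0, by simp [h0]⟩
  obtain ⟨r, rfl⟩ := h
  have hq0 : q ≠ 0 := left_ne_zero_of_mul h0
  have hr0 : r ≠ 0 := right_ne_zero_of_mul h0
  have h1 := totalDegree_mul_of_isDomain hq0 hr0
  rw [hp.totalDegree h0, hq.totalDegree hq0] at h1
  refine ⟨coeff 0 r, ?_⟩
  rw [mul_comm, ← totalDegree_eq_zero_iff_eq_C.mp (by omega : r.totalDegree = 0)]

/-- The coefficient vector of a derivation. -/
noncomputable def coeffMap : Dr →ₗ[S] (Fin n → S) := LinearMap.pi fun j => evalDer (X j)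

lemma coeffMap_apply (θ : Dr) (j : Fin n) : coeffMap θ j = θ (X j) := rfl

lemma linearIndependent_of_det_ne_zero {θ : Fin n → Dr}
    (h : (Matrix.of fun i j => θ i (X j)).det ≠ 0) : LinearIndependent S θ :=
  LinearIndependent.of_comp coeffMap (Matrix.linearIndependent_rows_of_det_ne_zero h)

/-- The Euler derivation. -/
noncomputable def euler (K : Type*) [Field K] (n : ℕ) :
    Derivation K (MvPolynomial (Fin n) K) (MvPolynomial (Fin n) K) :=
  mkDerivation K X

lemma euler_X (j : Fin n) : euler K n (X j) = X j := mkDerivation_X ..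

lemma euler_linPoly (f : (Fin n → K) →ₗ[K] K) : euler K n (linPoly f) = linPoly f := by
  simp [euler_X, linPoly]

lemma euler_mem {A : Arrangement K n} {Q : S} (hQ : IsDefiningPoly A Q) :
    euler K n ∈ DerModule Q :=
  hQ.mem_iff.mpr fun f _ _ => by rw [euler_linPoly]

end Determinants

section RankTwo

variable {K : Type*} [Field K]

local notation "S" => MvPolynomial (Fin 2) K
local notation "Dr" => Derivation K (MvPolynomial (Fin 2) K) (MvPolynomial (Fin 2) K)

/-- The derivation of the plane associated with the Hamiltonian `Q`. -/
noncomputable def hamiltonian (Q : S) : Dr := pderiv 1 Q • pderiv 0 - pderiv 0 Q • pderiv 1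

lemma hamiltonian_X (Q : S) :
    hamiltonian Q (X 0) = pderiv 1 Q ∧ hamiltonian Q (X 1) = -pderiv 0 Q := by
  simp [hamiltonian, pderiv_X]

lemma hamiltonian_mem (Q : S) : hamiltonian Q ∈ DerModule Q := by
  rw [mem_DerModule]
  simp [hamiltonian, mul_comm]

lemma hamiltonian_isHomogeneous {Q : S} {k : ℕ} (hQ : Q.IsHomogeneous k) (j : Fin 2) :
    (hamiltonian Q (X j)).IsHomogeneous (k - 1) := by
  fin_cases j
  · simpa [hamiltonian_X Q] using hQ.pderiv
  · simpa [hamiltonian_X Q] using hQ.pderiv.neg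

lemma X_mul_hamiltonian_sub {Q : S} {k : ℕ} (hQ : Q.IsHomogeneous k) :
    X 0 * hamiltonian Q (X 1) - X 1 * hamiltonian Q (X 0) = -(C (k : K) * Q) := by
  have := hQ.sum_X_mul_pderiv
  rw [Fin.sum_univ_two, nsmul_eq_mul] at this
  rw [(hamiltonian_X Q).1, (hamiltonian_X Q).2, map_natCast, ← this]
  ring

lemma C_mul_ne_zero {B : Arrangement K 2} {Q : S} (hQ : IsDefiningPoly B Q)
    (hB : (B.hyperplanes.card : K) ≠ 0) : -(C (B.hyperplanes.card : K) * Q) ≠ 0 :=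
  neg_ne_zero.mpr (mul_ne_zero (C_ne_zero.mpr hB) hQ.ne_zero)

lemma HasExponents.two_le_card_filter {B : Arrangement K 2} {e : Multiset ℕ}
    (h : HasExponents B e) (hB : (B.hyperplanes.card : K) ≠ 0) {k : ℕ} (hk : 1 ≤ k)
    (hBk : B.hyperplanes.card ≤ k + 1) : 2 ≤ (e.filter (· ≤ k)).card := by
  obtain ⟨Q, hQ, m, l, b, rfl, hb⟩ := h.exists_basis
  have hind : LinearIndependent S ![euler K 2, hamiltonian Q] := by
    refine linearIndependent_of_det_ne_zero ?_
    rw [Matrix.det_fin_two]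
    simpa [euler_X, mul_comm, X_mul_hamiltonian_sub hQ.isHomogeneous] using C_mul_ne_zero hQ hB
  have := le_card_degree_le b hb (m := 2) (d := k)
    ![⟨euler K 2, euler_mem hQ⟩, ⟨hamiltonian Q, hamiltonian_mem Q⟩] ?_ ?_
  · rw [Multiset.filter_map, Multiset.card_map]
    exact this
  · refine LinearIndependent.of_comp (DerModule Q).subtype ?_
    convert hind using 1
    ext i
    fin_cases i <;> rfl
  · intro i
    fin_cases i
    · exact ⟨1, hk, fun j => by simpa [euler_X] using isHomogeneous_X K j⟩
    · exact ⟨_, by omega, hamiltonian_isHomogeneous hQ.isHomogeneous⟩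

lemma HasExponents.exists_le_succ {B : Arrangement K 2} {e : Multiset ℕ}
    (h : HasExponents B e) (hB : (B.hyperplanes.card : K) ≠ 0) :
    ∃ m ∈ e, B.hyperplanes.card ≤ m + 1 := by
  obtain ⟨Q, hQ, r, l, b, rfl, hb⟩ := h.exists_basis
  by_contra! hlt
  let φ : Dr →ₗ[S] S := (X 0 : S) • evalDer (X 1) - (X 1 : S) • evalDer (X 0)
  have hφ (θ : Dr) : φ θ = X 0 * θ (X 1) - X 1 * θ (X 0) := rfl
  have h0 : φ ∘ₗ (DerModule Q).subtype = 0 := by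
    refine b.ext fun i => ?_
    have h1 := hQ.dvd_det ![euler K 2, b i] (by
      intro i'
      fin_cases i'
      · exact euler_mem hQ
      · exact (b i).2)
    rw [Matrix.det_fin_two] at h1
    simp only [Matrix.of_apply, Matrix.cons_val_zero, Matrix.cons_val_one, euler_X] at h1
    refine eq_zero_of_dvd_of_degree_lt (d := 1 + l i) ?_ hQ.isHomogeneous h1 ?_
    · exact ((isHomogeneous_X K _).mul (hb i 1)).sub ((isHomogeneous_X K _).mul (hb i 0))
    · have := hlt (l i) (Multiset.mem_map_of_mem _ (Finset.mem_univ_val i))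
      omega
  have h2 := LinearMap.congr_fun h0 ⟨hamiltonian Q, hamiltonian_mem Q⟩
  rw [LinearMap.comp_apply, Submodule.subtype_apply, hφ,
    X_mul_hamiltonian_sub hQ.isHomogeneous] at h2
  exact C_mul_ne_zero hQ hB h2

end RankTwo

section Vanishing

variable {K : Type*} [Field K]

lemma linPoly_sub {n : ℕ} (f g : (Fin n → K) →ₗ[K] K) :
    linPoly (f - g) = linPoly f - linPoly g := by
  simp [linPoly, sub_mul, Finset.sum_sub_distrib]

lemma linPoly_proj {n : ℕ} (j : Fin n) :
    linPoly (LinearMap.proj j : (Fin n → K) →ₗ[K] K) = X j := by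
  simp [linPoly, Pi.single_apply, apply_ite C]

lemma exists_smul_eq_of_ker {g : (Fin 2 → K) →ₗ[K] K} (hg : g ≠ 0) {x y : Fin 2 → K}
    (hx : g x = 0) (hy : g y = 0) (hx0 : x ≠ 0) : ∃ c : K, c • x = y := by
  have h1 : finrank K (LinearMap.ker g) = 1 := by
    have := Module.Dual.finrank_ker_add_one_of_ne_zero hg
    rw [finrank_fin_fun] at this
    omega
  obtain ⟨c, hc⟩ := exists_smul_eq_of_finrank_eq_one h1 (x := ⟨x, hx⟩)
    (by simpa [Subtype.ext_iff] using hx0) ⟨y, hy⟩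
  exact ⟨c, congrArg Subtype.val hc⟩

/-- Modulo a linear form, a polynomial agrees with its composition with a projection to the
kernel. -/
lemma linPoly_dvd_sub_aeval {n : ℕ} (f : (Fin n → K) →ₗ[K] K) (u : Fin n → K)
    (p : MvPolynomial (Fin n) K) :
    linPoly f ∣ p - aeval (fun i => X i - linPoly f * C (u i)) p := by
  rw [← Ideal.mem_span_singleton, ← Ideal.Quotient.eq]
  have : (Ideal.Quotient.mkₐ K (Ideal.span {linPoly f})) =
      (Ideal.Quotient.mkₐ K (Ideal.span {linPoly f})).comp
        (aeval (fun i => X i - linPoly f * C (u i))) := by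
    refine algHom_ext fun i => ?_
    rw [AlgHom.comp_apply, aeval_X, Ideal.Quotient.mkₐ_eq_mk, Ideal.Quotient.eq,
      Ideal.mem_span_singleton]
    exact ⟨C (u i), by ring⟩
  exact DFunLike.congr_fun this p

lemma aeval_mul_of_isHomogeneous {n : ℕ} {R : Type*} [CommRing R] [Algebra K R]
    {p : MvPolynomial (Fin n) K} {d : ℕ} (hp : p.IsHomogeneous d) (r : R) (x : Fin n → R) :
    aeval (fun i => r * x i) p = r ^ d * aeval x p := by
  conv_lhs => rw [p.as_sum]
  conv_rhs => rw [p.as_sum]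
  rw [map_sum, map_sum, Finset.mul_sum]
  refine Finset.sum_congr rfl fun m hm => ?_
  have hd : ∑ i, m i = d := by
    have := hp (mem_support_iff.mp hm)
    rw [← this, Finsupp.weight_apply, Finsupp.sum_fintype _ _ (by simp)]
    simp
  rw [aeval_monomial, aeval_monomial, Finsupp.prod_fintype _ _ (by simp),
    Finsupp.prod_fintype _ _ (by simp)]
  simp only [mul_pow, Finset.prod_mul_distrib, Finset.prod_pow_eq_pow_sum, hd]
  ring

lemma eval_aeval {σ τ : Type*} (g : σ → MvPolynomial τ K) (p : MvPolynomial σ K) (x : τ → K) :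
    eval x (aeval g p) = eval (fun j => eval x (g j)) p := by
  induction p using MvPolynomial.induction_on with
  | C a => simp
  | add p q hp hq => rw [map_add, map_add, map_add, hp, hq]
  | mul_X p i hp => rw [map_mul, map_mul, map_mul, aeval_X, eval_X, hp]

lemma aeval_linPoly {m n : ℕ} (g : (Fin m → K) →ₗ[K] K) (β : Fin m → (Fin n → K) →ₗ[K] K) :
    aeval (fun k => linPoly (β k)) (linPoly g) = linPoly (g ∘ₗ LinearMap.pi β) := by
  have hs (k : Fin m) : (fun j : Fin m => if k = j then (1 : K) else 0) = Pi.single k 1 := by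
    ext j
    simp [Pi.single_apply, eq_comm]
  have h (x : Fin n → K) : g (LinearMap.pi β x) = ∑ k, g (Pi.single k 1) * β k x := by
    rw [LinearMap.pi_apply_eq_sum_univ g]
    simp [hs, mul_comm]
  simp only [linPoly, map_sum, map_mul, aeval_C, aeval_X, LinearMap.comp_apply, h, algebraMap_eq,
    Finset.mul_sum, Finset.sum_mul, mul_assoc]
  exact Finset.sum_comm

lemma linPoly_dvd_of_eval_eq_zero {p : MvPolynomial (Fin 2) K} {d : ℕ} (hp : p.IsHomogeneous d)
    {f : (Fin 2 → K) →ₗ[K] K} (hf : f ≠ 0) (h : ∀ x, f x = 0 → eval x p = 0) :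
    linPoly f ∣ p := by
  obtain ⟨i, hi⟩ := exists_single_ne_zero hf
  set u : Fin 2 → K := (f (Pi.single i 1))⁻¹ • Pi.single i 1 with hu
  have hfu : f u = 1 := by rw [hu, map_smul, smul_eq_mul, inv_mul_cancel₀ hi]
  have h2 := linPoly_dvd_sub_aeval f u p
  suffices aeval (fun j => X j - linPoly f * C (u j)) p = 0 by rwa [this, sub_zero] at h2
  obtain ⟨q, hq, hq0⟩ : ∃ q, f q = 0 ∧ q ≠ 0 := by
    refine ⟨![f (Pi.single 1 1), -f (Pi.single 0 1)], ?_, fun h0 => ?_⟩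
    · rw [LinearMap.pi_apply_eq_sum_univ f]
      simp only [Fin.sum_univ_two, cons_val_zero, cons_val_one, smul_eq_mul]
      have hs (k : Fin 2) : (fun j : Fin 2 => if k = j then (1 : K) else 0) = Pi.single k 1 := by
        ext j
        simp [Pi.single_apply, eq_comm]
      rw [hs, hs]
      ring
    · have h3 := congrFun h0 0
      have h4 := congrFun h0 1
      simp only [cons_val_zero, cons_val_one, Pi.zero_apply, neg_eq_zero] at h3 h4
      fin_cases i
      · exact hi h4
      · exact hi h3
  have hproj (x : Fin 2 → K) : ∃ c : K, c • q = x - f x • u :=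
    exists_smul_eq_of_ker hf hq (by simp [hfu]) hq0
  choose c hc using hproj
  have hlin : (fun j : Fin 2 => (X j : MvPolynomial (Fin 2) K) - linPoly f * C (u j)) =
      fun j => (∑ k, C (c (Pi.single k 1)) * X k) * C (q j) := by
    funext j
    have hk (k : Fin 2) : c (Pi.single k 1) * q j =
        (Pi.single k 1 : Fin 2 → K) j - f (Pi.single k 1) * u j := by
      simpa using congrFun (hc (Pi.single k 1)) j
    have hk' (k : Fin 2) : C (c (Pi.single k 1)) * C (q j) = (C ((Pi.single k 1 : Fin 2 → K) j) -
        C (f (Pi.single k 1)) * C (u j) : MvPolynomial (Fin 2) K) := by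
      rw [← C_mul, hk, C_sub, C_mul]
    have h0 := hk' 0
    have h1 := hk' 1
    rw [linPoly, Fin.sum_univ_two, Fin.sum_univ_two]
    fin_cases j <;> simp at h0 h1 ⊢ <;> linear_combination (-X 0) * h0 - X 1 * h1
  rw [hlin, aeval_mul_of_isHomogeneous hp]
  have : aeval (fun i => (C (q i) : MvPolynomial (Fin 2) K)) p = C (eval q p) := by
    rw [← algebraMap_eq]
    exact aeval_algebraMap_apply (MvPolynomial (Fin 2) K) q p
  rw [this, h q hq, C_0, mul_zero]

lemma eq_zero_of_eval_eq_zero {p : MvPolynomial (Fin 2) K} {d : ℕ} (hp : p.IsHomogeneous d)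
    (B : Arrangement K 2) (hd : d < B.hyperplanes.card)
    (h : ∀ H ∈ B.hyperplanes, ∀ x ∈ H, eval x p = 0) : p = 0 := by
  obtain ⟨Q, hQ⟩ := exists_isDefiningPoly B
  exact eq_zero_of_dvd_of_degree_lt hp hQ.isHomogeneous
    (hQ.dvd_of_forall_dvd fun f hf hB => linPoly_dvd_of_eval_eq_zero hp hf fun x hx =>
      h _ hB x hx) hd

/-- A form of small degree vanishing on many lines of a plane is divisible by the linear form
of that plane. -/
lemma linPoly_dvd_of_vanishing {n : ℕ} {p : MvPolynomial (Fin n) K} {d : ℕ}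
    (hp : p.IsHomogeneous d) {f : (Fin n → K) →ₗ[K] K} (hf : f ≠ 0)
    (L : (Fin 2 → K) ≃ₗ[K] LinearMap.ker f) (B : Arrangement K 2)
    (hd : d < B.hyperplanes.card)
    (h : ∀ H ∈ B.hyperplanes, ∀ x ∈ H, eval (L x : Fin n → K) p = 0) : linPoly f ∣ p := by
  obtain ⟨i, hi⟩ := exists_single_ne_zero hf
  set u : Fin n → K := (f (Pi.single i 1))⁻¹ • Pi.single i 1 with hu
  have hfu : f u = 1 := by rw [hu, map_smul, smul_eq_mul, inv_mul_cancel₀ hi]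
  have h2 := linPoly_dvd_sub_aeval f u p
  suffices aeval (fun j => X j - linPoly f * C (u j)) p = 0 by rwa [this, sub_zero] at h2
  let g : Fin n → (Fin 2 → K) →ₗ[K] K := fun j =>
    LinearMap.proj j ∘ₗ (LinearMap.ker f).subtype ∘ₗ L.toLinearMap
  have hg (j : Fin n) (x : Fin 2 → K) : g j x = (L x : Fin n → K) j := rfl
  have hpL : aeval (fun j => linPoly (g j)) p = 0 := by
    refine eq_zero_of_eval_eq_zero (d := d) ?_ B hd fun H hH x hx => ?_
    · have := hp.aeval (fun j => linPoly (g j)) (n := 1) fun j => linPoly_isHomogeneous _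
      simpa using this
    · rw [← h H hH x hx, eval_aeval]
      simp only [eval_linPoly, hg]
  let π : (Fin n → K) →ₗ[K] LinearMap.ker f :=
    LinearMap.codRestrict _ (LinearMap.id - f.smulRight u) (by simp [hfu])
  let β : Fin 2 → (Fin n → K) →ₗ[K] K := fun k =>
    LinearMap.proj k ∘ₗ L.symm.toLinearMap ∘ₗ π
  have hcomp : (aeval (fun k => linPoly (β k))).comp (aeval fun j => linPoly (g j)) =
      aeval (R := K) (fun j => X j - linPoly f * C (u j)) := by
    refine algHom_ext fun j => ?_
    have hcoord : g j ∘ₗ LinearMap.pi β = LinearMap.proj j - u j • f := by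
      refine LinearMap.ext fun x => ?_
      have : g j (LinearMap.pi β x) = (L (L.symm (π x)) : Fin n → K) j := rfl
      rw [LinearMap.comp_apply, this, L.apply_symm_apply]
      change x j - f x * u j = x j - u j * f x
      rw [mul_comm]
    rw [AlgHom.comp_apply, aeval_X, aeval_X, aeval_linPoly, hcoord, linPoly_sub, linPoly_proj,
      linPoly_smul, mul_comm]
  rw [← hcomp, AlgHom.comp_apply, hpL, map_zero]

end Vanishing
section Criterion

variable {K : Type*} [Field K]

local notation "S" => MvPolynomial (Fin 3) K
local notation "Dr" => Derivation K (MvPolynomial (Fin 3) K) (MvPolynomial (Fin 3) K)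

lemma smul_linPoly_mem {n : ℕ} {A A' : Arrangement K n} {Q Q' : MvPolynomial (Fin n) K}
    (hQ : IsDefiningPoly A Q) (hQ' : IsDefiningPoly A' Q') {f : (Fin n → K) →ₗ[K] K}
    (hA : A.delete (LinearMap.ker f) = A')
    {θ : Derivation K (MvPolynomial (Fin n) K) (MvPolynomial (Fin n) K)}
    (hθ : θ ∈ DerModule Q') : linPoly f • θ ∈ DerModule Q := by
  refine hQ.mem_iff.mpr fun g hg hgA => ?_
  rw [Derivation.smul_apply, smul_eq_mul]
  by_cases h : LinearMap.ker g = LinearMap.ker f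
  · exact (linPoly_dvd_of_ker_eq h.symm).mul_right _
  · refine (hQ'.mem_iff.mp hθ g hg ?_).mul_left _
    rw [← hA]
    exact Finset.mem_erase.mpr ⟨h, hgA⟩

lemma mem_of_delete {n : ℕ} {A A' : Arrangement K n} {Q Q' : MvPolynomial (Fin n) K}
    (hQ : IsDefiningPoly A Q) (hQ' : IsDefiningPoly A' Q') {f : (Fin n → K) →ₗ[K] K}
    (hA : A.delete (LinearMap.ker f) = A')
    {θ : Derivation K (MvPolynomial (Fin n) K) (MvPolynomial (Fin n) K)}
    (hθ : θ ∈ DerModule Q') (hfθ : linPoly f ∣ θ (linPoly f)) : θ ∈ DerModule Q := by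
  refine hQ.mem_iff.mpr fun g hg hgA => ?_
  by_cases h : LinearMap.ker g = LinearMap.ker f
  · obtain ⟨c, rfl⟩ := exists_eq_smul_of_ker_le h.ge
    rw [linPoly_smul, ← smul_eq_C_mul, Derivation.map_smul, smul_eq_C_mul, smul_eq_C_mul]
    exact mul_dvd_mul_left _ hfθ
  · refine hQ'.mem_iff.mp hθ g hg ?_
    rw [← hA]
    exact Finset.mem_erase.mpr ⟨h, hgA⟩

lemma dvd_of_mem_of_delete {n : ℕ} {A A' : Arrangement K n} {Q Q' : MvPolynomial (Fin n) K}
    (hQ : IsDefiningPoly A Q) (hQ' : IsDefiningPoly A' Q')  {H : Submodule K (Fin n → K)}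
    (hA : A.delete H = A')
    {θ : Derivation K (MvPolynomial (Fin n) K) (MvPolynomial (Fin n) K)}
    (hθ : θ ∈ DerModule Q) : θ ∈ DerModule Q' := by
  refine hQ'.mem_iff.mpr fun g hg hgA => hQ.mem_iff.mp hθ g hg ?_
  rw [← hA] at hgA
  exact Finset.mem_of_mem_erase hgA

/-- A derivation of `A` of small degree is radial along a hyperplane whose restriction has many
lines. -/
lemma linPoly_dvd_minor {A : Arrangement K 3} {Q : S} (hQ : IsDefiningPoly A Q)
    {f : (Fin 3 → K) →ₗ[K] K} (hf : f ≠ 0) (hfA : LinearMap.ker f ∈ A.hyperplanes)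
    {B : Arrangement K 2} (hB : IsRestriction A (LinearMap.ker f) B) {θ : Dr}
    (hθ : θ ∈ DerModule Q) {d : ℕ} (hom : ∀ j, (θ (X j)).IsHomogeneous d)
    (hd : d + 1 < B.hyperplanes.card) (i j : Fin 3) :
    linPoly f ∣ X i * θ (X j) - X j * θ (X i) := by
  obtain ⟨e, he⟩ := hB
  have hval (g : (Fin 3 → K) →ₗ[K] K) (hg : g ≠ 0) (hgA : LinearMap.ker g ∈ A.hyperplanes)
      (p : Fin 3 → K) (hp : g p = 0) : g (fun k => eval p (θ (X k))) = 0 := by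
    obtain ⟨r, hr⟩ := hQ.mem_iff.mp hθ g hg hgA
    have := congrArg (eval p) hr
    rw [map_mul, eval_linPoly, hp, zero_mul, der_linPoly, map_sum] at this
    rw [← this, LinearMap.pi_apply_eq_sum_univ g]
    refine Finset.sum_congr rfl fun k _ => ?_
    rw [map_mul, eval_C, smul_eq_mul, mul_comm]
    congr 2
    ext j
    simp [Pi.single_apply, eq_comm]
  refine linPoly_dvd_of_vanishing (d := 1 + d) (((isHomogeneous_X K i).mul (hom j)).sub
    ((isHomogeneous_X K j).mul (hom i))) hf e.symm B (by omega) fun H hH x hx => ?_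
  obtain ⟨g₂, hg₂, hH₂⟩ := B.isHyp H hH
  rw [he, Finset.mem_image] at hH
  obtain ⟨H', hH', rfl⟩ := hH
  rw [Finset.mem_erase] at hH'
  obtain ⟨g, hg, rfl⟩ := A.isHyp H' hH'.2
  obtain ⟨⟨p, hpf⟩, hpg, rfl⟩ := hx
  simp only [LinearEquiv.coe_coe, LinearEquiv.symm_apply_apply]
  set y : Fin 3 → K := fun k => eval p (θ (X k)) with hy
  have hyf : f y = 0 := hval f hf hfA p hpf
  have hyg : g y = 0 := hval g hg hH'.2 p hpg
  by_cases hp0 : p = 0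
  · have hx (k : Fin 3) : p k = 0 := by rw [hp0]; rfl
    simp [hx]
  obtain ⟨c, hc⟩ := exists_smul_eq_of_ker hg₂ (x := e ⟨p, hpf⟩) (y := e ⟨y, hyf⟩)
    (LinearMap.mem_ker.mp (hH₂ ▸ ⟨_, hpg, rfl⟩)) (LinearMap.mem_ker.mp (hH₂ ▸ ⟨_, hyg, rfl⟩))
    (by simpa [Subtype.ext_iff] using hp0)
  rw [← map_smul, e.injective.eq_iff, Subtype.ext_iff] at hc
  have hk (k : Fin 3) : eval p (θ (X k)) = c * p k := (congrFun hc k).symm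
  rw [map_sub, map_mul, map_mul, eval_X, eval_X, hk, hk]
  ring

end Criterion
section Criterion

variable {K : Type*} [Field K]

local notation "S" => MvPolynomial (Fin 3) K
local notation "Dr" => Derivation K (MvPolynomial (Fin 3) K) (MvPolynomial (Fin 3) K)

lemma der_smul_eq_zero {n : ℕ} {p : MvPolynomial (Fin n) K} (hp : p ≠ 0)
    {θ : Derivation K (MvPolynomial (Fin n) K) (MvPolynomial (Fin n) K)} (h : p • θ = 0) :
    θ = 0 := by
  refine der_eq_zero_iff.mpr fun i => ?_
  have := der_eq_zero_iff.mp h i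
  rw [Derivation.smul_apply, smul_eq_mul] at this
  exact (mul_eq_zero.mp this).resolve_left hp

lemma linearIndependent_smul_basis {n : ℕ} {ι : Type*} [Fintype ι]
    {D : Submodule (MvPolynomial (Fin n) K)
      (Derivation K (MvPolynomial (Fin n) K) (MvPolynomial (Fin n) K))}
    (b : Basis ι (MvPolynomial (Fin n) K) D) {p : MvPolynomial (Fin n) K} (hp : p ≠ 0) :
    LinearIndependent (MvPolynomial (Fin n) K) fun i => p • (b i :
      Derivation K (MvPolynomial (Fin n) K) (MvPolynomial (Fin n) K)) := by
  refine Fintype.linearIndependent_iff.mpr fun g hg i => ?_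
  have h0 : ∑ i, g i • b i = 0 := by
    refine Subtype.ext (der_smul_eq_zero hp (derivation_ext fun j => ?_))
    have h := congrArg (fun θ => θ (X j)) hg
    simp only [der_sum_apply, Derivation.zero_apply] at h
    simp only [AddSubmonoidClass.coe_finsetSum, Submodule.coe_smul, Derivation.smul_apply,
      der_sum_apply, smul_eq_mul, Finset.mul_sum, Derivation.zero_apply] at h ⊢
    rw [← h]
    exact Finset.sum_congr rfl fun k _ => mul_left_comm ..
  have h1 := congrFun (b.repr_sum_self g) i
  rwa [h0, map_zero, Finsupp.zero_apply, eq_comm] at h1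

lemma card_le_of_basis {n m : ℕ} {D : Submodule (MvPolynomial (Fin n) K)
      (Derivation K (MvPolynomial (Fin n) K) (MvPolynomial (Fin n) K))}
    (b : Basis (Fin m) (MvPolynomial (Fin n) K) D) : m ≤ n := by
  let φ : D →ₗ[MvPolynomial (Fin n) K] (Fin n → MvPolynomial (Fin n) K) :=
    coeffMap ∘ₗ D.subtype
  have hφ : Function.Injective φ := fun θ θ' h =>
    Subtype.ext (derivation_ext fun i => congrFun h i)
  have := LinearMap.finrank_le_finrank_of_injective hφ
  rwa [finrank_fin_fun, finrank_eq_card_basis b, Fintype.card_fin] at this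

lemma not_hasExponents_delete {A : Arrangement K 3} {Q : S} (hQ : IsDefiningPoly A Q)
    (b : Basis (Fin 3) S (DerModule Q))
    (hb : ∀ i j, ((b i : Dr) (X j)).IsHomogeneous (![1, 11, 15] i))
    (hb0 : (b 0 : Dr) = euler K 3) {H : Submodule K (Fin 3 → K)} (hH : H ∈ A.hyperplanes)
    (hp : ∃ p ∈ H, ∀ a c : K, (∀ j, a * p j + c * eval p ((b 1 : Dr) (X j)) = 0) → c = 0)
    {e : Multiset ℕ} (he : HasExponents (A.delete H) e) (hcard : 2 ≤ (e.filter (· ≤ 10)).card) :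
    False := by
  obtain ⟨f, hf, rfl⟩ := A.isHyp H hH
  obtain ⟨Q', hQ', m, l, φ, rfl, hφ⟩ := he.exists_basis
  rw [Multiset.filter_map, Multiset.card_map] at hcard
  obtain ⟨i, hi, j, hj, hij⟩ := Finset.one_lt_card.mp
    (show 1 < (Finset.univ.filter fun i => l i ≤ 10).card from hcard)
  obtain ⟨p, hpH, hp⟩ := hp
  have hf0 := (linPoly_prime hf).ne_zero
  have radial (i : Fin m) (hi : l i ≤ 10) : ∃ a : S, linPoly f • (φ i : Dr) = a • euler K 3 := by
    let θ : DerModule Q := ⟨linPoly f • (φ i : Dr), smul_linPoly_mem hQ hQ' rfl (φ i).2⟩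
    have hθ (j : Fin 3) : ((θ : Dr) (X j)).IsHomogeneous (1 + l i) :=
      (linPoly_isHomogeneous f).mul (hφ i j)
    have h2 : b.repr θ 2 = 0 := basis_repr_eq_zero b hb hθ (show 1 + l i < 15 by omega)
    have h1 : (b.repr θ 1).IsHomogeneous 0 := by
      have := basis_repr_isHomogeneous b hb hθ 1
      rwa [show 1 + l i - ![1, 11, 15] 1 = 0 from by
        change 1 + l i - 11 = 0
        omega] at this
    obtain ⟨c, hc⟩ : ∃ c, b.repr θ 1 = C c :=
      ⟨_, totalDegree_eq_zero_iff_eq_C.mp (Nat.le_zero.mp h1.totalDegree_le)⟩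
    have hsum : (θ : Dr) = b.repr θ 0 • euler K 3 + (C c : S) • (b 1 : Dr) := by
      conv_lhs => rw [← b.sum_repr θ]
      rw [Fin.sum_univ_three, h2, zero_smul, add_zero, hc, ← hb0]
      rfl
    have hc0 : c = 0 := by
      refine hp (eval p (b.repr θ 0)) c fun j => ?_
      have h3 := congrArg (fun θ : Dr => eval p (θ (X j))) hsum
      simp only [Derivation.add_apply, Derivation.smul_apply, smul_eq_mul, map_add, map_mul,
        euler_X, eval_X, eval_C] at h3
      rw [← h3]
      change eval p (linPoly f * (φ i : Dr) (X j)) = 0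
      rw [map_mul, eval_linPoly, LinearMap.mem_ker.mp hpH, zero_mul]
    exact ⟨b.repr θ 0, by rw [hc0, C_0, zero_smul, add_zero] at hsum; exact hsum⟩
  obtain ⟨a, ha⟩ := radial i (by simpa using hi)
  obtain ⟨a', ha'⟩ := radial j (by simpa using hj)
  have hrel : (a' * linPoly f) • φ i + (-(a * linPoly f)) • φ j = 0 := by
    refine Subtype.ext ?_
    change (a' * linPoly f) • (φ i : Dr) + (-(a * linPoly f)) • (φ j : Dr) = 0
    refine derivation_ext fun k => ?_
    have h1 := congrArg (fun θ : Dr => θ (X k)) ha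
    have h2 := congrArg (fun θ : Dr => θ (X k)) ha'
    simp only [Derivation.smul_apply, Derivation.add_apply, Derivation.zero_apply,
      smul_eq_mul] at h1 h2 ⊢
    linear_combination a' * h1 - a * h2
  have ha0 : a' = 0 := by
    have := congrArg (fun x => φ.repr x i) hrel
    simpa [Finsupp.single_apply, hij.symm, hf0] using this
  rw [ha0, zero_smul] at ha'
  exact φ.ne_zero j (Subtype.ext (der_smul_eq_zero hf0 ha'))

end Criterion
section Criterion

variable {K : Type*} [Field K]

local notation "S" => MvPolynomial (Fin 3) K
local notation "Dr" => Derivation K (MvPolynomial (Fin 3) K) (MvPolynomial (Fin 3) K)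

lemma eq_and_forall_le_of_card_filter {r : ℕ} {l : Fin r → ℕ} (hr : r ≤ 3)
    (h16 : 3 ≤ (Finset.univ.filter fun i => l i ≤ 16).card)
    (h12 : 2 ≤ (Finset.univ.filter fun i => l i ≤ 12).card) {i₀ : Fin r} (hi₀ : 16 ≤ l i₀) :
    l i₀ = 16 ∧ ∀ i ≠ i₀, l i ≤ 12 := by
  constructor
  · have huniv : (Finset.univ.filter fun i => l i ≤ 16) = Finset.univ :=
      Finset.eq_univ_of_card _ (le_antisymm (Finset.card_le_univ _) (by simpa using hr.trans h16))
    have := (Finset.filter_eq_self.mp huniv) i₀ (Finset.mem_univ _)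
    omega
  · intro i hi
    by_contra! hlt
    have hsub : (Finset.univ.filter fun i => l i ≤ 12) ⊆ ({i, i₀} : Finset (Fin r))ᶜ := by
      intro k hk
      simp only [Finset.mem_filter, Finset.mem_univ, true_and] at hk
      simp only [Finset.mem_compl, Finset.mem_insert, Finset.mem_singleton, not_or]
      constructor <;> rintro rfl <;> omega
    have := Finset.card_le_card hsub
    rw [Finset.card_compl, Finset.card_pair hi, Fintype.card_fin] at this
    omega

lemma not_dvd_second_basis {A : Arrangement K 3} {Q : S} (hQ : IsDefiningPoly A Q)
    (b : Basis (Fin 3) S (DerModule Q)) (hb1 : (b 1 : Dr) (X 0) = 0)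
    (hX : LinearMap.ker (LinearMap.proj 0 : (Fin 3 → K) →ₗ[K] K) ∈ A.hyperplanes)
    {f : (Fin 3 → K) →ₗ[K] K} (hf : f ≠ 0) (hfA : LinearMap.ker f ∉ A.hyperplanes) :
    ∃ j, ¬ linPoly f ∣ X 0 * (b 1 : Dr) (X j) - X j * (b 1 : Dr) (X 0) := by
  by_contra! h
  have hprime := linPoly_prime hf
  have hX0 : ¬ linPoly f ∣ (X 0 : S) := fun hd => by
    rw [← linPoly_proj] at hd
    refine hfA (ker_eq_of_linPoly_dvd ?_ hd ▸ hX)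
    intro h0
    have := LinearMap.congr_fun h0 (Pi.single 0 1)
    simp at this
  have hdvd (j : Fin 3) : linPoly f ∣ (b 1 : Dr) (X j) := by
    have := h j
    rw [hb1, mul_zero, sub_zero] at this
    exact (hprime.dvd_mul.mp this).resolve_left hX0
  choose q hq using hdvd
  have hη : (b 1 : Dr) = linPoly f • mkDerivation K q := derivation_ext fun j => by
    rw [Derivation.smul_apply, mkDerivation_X, smul_eq_mul, hq]
  have hmem : mkDerivation K q ∈ DerModule Q := by
    refine hQ.mem_iff.mpr fun g hg hgA => ?_
    have := hQ.mem_iff.mp (b 1).2 g hg hgA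
    rw [hη, Derivation.smul_apply, smul_eq_mul] at this
    refine ((linPoly_prime hg).dvd_mul.mp this).resolve_left fun hd => hfA ?_
    exact ker_eq_of_linPoly_dvd hf hd ▸ hgA
  have hbη : b 1 = linPoly f • (⟨mkDerivation K q, hmem⟩ : DerModule Q) := Subtype.ext hη
  have h1 : b.repr (b 1) 1 = 1 := by simp
  rw [hbη, map_smul, Finsupp.smul_apply, smul_eq_mul] at h1
  exact hprime.not_isUnit (IsUnit.of_mul_eq_one _ h1)

lemma not_hasExponents_of_delete_eq {A A' : Arrangement K 3} {Q : S} (hQ : IsDefiningPoly A Q)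
    (b : Basis (Fin 3) S (DerModule Q))
    (hb : ∀ i j, ((b i : Dr) (X j)).IsHomogeneous (![1, 11, 15] i))
    (hb1 : (b 1 : Dr) (X 0) = 0)
    (hX : LinearMap.ker (LinearMap.proj 0 : (Fin 3 → K) →ₗ[K] K) ∈ A.hyperplanes)
    {H : Submodule K (Fin 3 → K)} (hH : H ∈ A'.hyperplanes) (hA' : A'.delete H = A)
    {B : Arrangement K 2} (hB : IsRestriction A' H B) (hcard : 13 ≤ B.hyperplanes.card)
    {e : Multiset ℕ} (he : HasExponents A' e) {d : ℕ} (hd : 16 ≤ d) (hde : d ∈ e) : False := by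
  obtain ⟨f, hf, rfl⟩ := A'.isHyp H hH
  have hfA : LinearMap.ker f ∉ A.hyperplanes := by
    rw [← hA']
    exact Finset.notMem_erase _ _
  obtain ⟨Q', hQ', r, l, φ, rfl, hφ⟩ := he.exists_basis
  have hprime := linPoly_prime hf
  have hf0 := hprime.ne_zero
  have hθf : ¬ linPoly f ∣ (b 1 : Dr) (linPoly f) := by
    intro h
    obtain ⟨j, hj⟩ := not_dvd_second_basis hQ b hb1 hX hf hfA
    exact hj (linPoly_dvd_minor hQ' hf hH hB (mem_of_delete hQ' hQ hA' (b 1).2 h) (d := 11)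
      (hb 1) (by omega) 0 j)
  let v : Fin 3 → DerModule Q' := fun k =>
    ⟨linPoly f • (b k : Dr), smul_linPoly_mem hQ' hQ hA' (b k).2⟩
  have hv : LinearIndependent S v := by
    exact LinearIndependent.of_comp (DerModule Q').subtype (linearIndependent_smul_basis b hf0)
  have hvhom (k : Fin 3) (j : Fin 3) : ((v k : Dr) (X j)).IsHomogeneous (1 + ![1, 11, 15] k) :=
    (linPoly_isHomogeneous f).mul (hb k j)
  have h16 : 3 ≤ (Finset.univ.filter fun i => l i ≤ 16).card :=
    le_card_degree_le φ hφ v hv fun k => ⟨_, by fin_cases k <;> simp, hvhom k⟩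
  have h12 : 2 ≤ (Finset.univ.filter fun i => l i ≤ 12).card :=
    le_card_degree_le φ hφ (v ∘ Fin.castSucc) (hv.comp _ (Fin.castSucc_injective 2))
      fun k => ⟨_, by fin_cases k <;> simp, hvhom k.castSucc⟩
  obtain ⟨i₀, -, rfl⟩ := Multiset.mem_map.mp hde
  obtain ⟨hi₀, hlt⟩ := eq_and_forall_le_of_card_filter (card_le_of_basis φ) h16 h12 hd
  let ψ : Fin r → DerModule Q := fun i => ⟨φ i, dvd_of_mem_of_delete hQ' hQ hA' (φ i).2⟩
  have hψ (i : Fin r) (hi : i ≠ i₀) : b.repr (ψ i) 2 = 0 :=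
    basis_repr_eq_zero b hb (hφ i) (show l i < 15 by have := hlt i hi; omega)
  have hψ₀ : (b.repr (ψ i₀) 2).IsHomogeneous 1 := by
    have := basis_repr_isHomogeneous b hb (θ := ψ i₀) (hφ i₀) 2
    rwa [hi₀] at this
  have hexp (θ : Dr) (hθ : θ ∈ DerModule Q) (hθ' : θ ∈ DerModule Q') (k : Fin 3) :
      b.repr ⟨θ, hθ⟩ k = ∑ i, φ.repr ⟨θ, hθ'⟩ i * b.repr (ψ i) k := by
    have : (⟨θ, hθ⟩ : DerModule Q) = ∑ i, φ.repr ⟨θ, hθ'⟩ i • ψ i := by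
      refine Subtype.ext ?_
      have h1 := congrArg Subtype.val (φ.sum_repr ⟨θ, hθ'⟩)
      simp only [AddSubmonoidClass.coe_finsetSum, Submodule.coe_smul] at h1 ⊢
      exact h1.symm
    rw [this, map_sum, Finsupp.finsetSum_apply]
    simp
  have hdvd₂ : linPoly f ∣ b.repr (ψ i₀) 2 := by
    have h1 := hexp (linPoly f • (b 2 : Dr)) (Submodule.smul_mem _ _ (b 2).2) (v 2).2 2
    rw [Finset.sum_eq_single i₀ (fun i _ hi => by rw [hψ i hi, mul_zero]) (by simp)] at h1
    have h2 : b.repr (⟨linPoly f • (b 2 : Dr), Submodule.smul_mem _ _ (b 2).2⟩ : DerModule Q) 2 =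
        linPoly f := by
      change b.repr (linPoly f • b 2) 2 = _
      simp
    rw [h2] at h1
    rcases hprime.irreducible.isUnit_or_isUnit h1 with hu | hu
    · exact ((hu.dvd_mul_left).mp h1.dvd)
    · exfalso
      obtain ⟨c, hc⟩ := isUnit_iff_eq_C_of_isReduced.mp hu
      have h0 := hψ₀.totalDegree hu.ne_zero
      rw [hc.2, totalDegree_C] at h0
      exact zero_ne_one h0
  let ξ : DerModule Q := (b 1 : Dr) (linPoly f) • b 2 + -(b 2 : Dr) (linPoly f) • b 1
  have hξ : (ξ : Dr) (linPoly f) = 0 := by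
    change (b 1 : Dr) (linPoly f) * (b 2 : Dr) (linPoly f) +
      -(b 2 : Dr) (linPoly f) * (b 1 : Dr) (linPoly f) = 0
    ring
  have h1 := hexp ξ ξ.2 (mem_of_delete hQ' hQ hA' ξ.2 (hξ ▸ dvd_zero _)) 2
  have h2 : b.repr ξ 2 = (b 1 : Dr) (linPoly f) := by
    rw [map_add, map_smul, map_smul, Finsupp.add_apply, Finsupp.smul_apply, Finsupp.smul_apply,
      b.repr_self, b.repr_self]
    simp
  refine hθf ?_
  rw [← h2]
  refine h1 ▸ Finset.dvd_sum fun i _ => Dvd.dvd.mul_left ?_ _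
  by_cases hi : i = i₀
  · exact hi ▸ hdvd₂
  · exact hψ i hi ▸ dvd_zero _

end Criterion
section Criterion

variable {K : Type*} [Field K]

local notation "S" => MvPolynomial (Fin 3) K
local notation "Dr" => Derivation K (MvPolynomial (Fin 3) K) (MvPolynomial (Fin 3) K)

theorem not_recursivelyFree {A : Arrangement K 3} {Q : S} (hQ : IsDefiningPoly A Q)
    (b : Basis (Fin 3) S (DerModule Q))
    (hb : ∀ i j, ((b i : Dr) (X j)).IsHomogeneous (![1, 11, 15] i))
    (hb0 : (b 0 : Dr) = euler K 3) (hb1 : (b 1 : Dr) (X 0) = 0)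
    (hX : LinearMap.ker (LinearMap.proj 0 : (Fin 3 → K) →ₗ[K] K) ∈ A.hyperplanes)
    (hchar : ∀ m : ℕ, 0 < m → m ≤ A.hyperplanes.card → (m : K) ≠ 0)
    (hin : ∀ H ∈ A.hyperplanes, ∀ B, IsRestriction A H B →
      0 < B.hyperplanes.card ∧ B.hyperplanes.card ≤ 11)
    (hp : ∀ H ∈ A.hyperplanes, ∃ p ∈ H, ∀ a c : K,
      (∀ j, a * p j + c * eval p ((b 1 : Dr) (X j)) = 0) → c = 0)
    (hout : ∀ (A' : Arrangement K 3) (H : Submodule K (Fin 3 → K)), H ∈ A'.hyperplanes →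
      A'.delete H = A → ∀ B, IsRestriction A' H B → 17 ≤ B.hyperplanes.card) :
    ¬ RecursivelyFree K A := by
  have hne : A.hyperplanes.Nonempty := ⟨_, hX⟩
  have hcard {A : Arrangement K 3} {H : Submodule K (Fin 3 → K)} {B : Arrangement K 2}
      (hB : IsRestriction A H B) : B.hyperplanes.card ≤ (A.delete H).hyperplanes.card := by
    obtain ⟨e, he⟩ := hB
    rw [he]
    exact Finset.card_image_le
  intro h
  cases h with
  | empty => simp [emptyArr] at hne
  | add _ H hH B hB e' e'' _ _ h3 h4 h5 =>
    obtain ⟨h0, h11⟩ := hin H hH B hB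
    have hB0 := hchar _ h0 ((hcard hB).trans (Finset.card_le_card (Finset.erase_subset _ _)))
    refine not_hasExponents_delete hQ b hb hb0 hH (hp H hH) h3 ?_
    exact (h4.two_le_card_filter hB0 (k := 10) (by norm_num) h11).trans
      (Multiset.card_le_card (Multiset.filter_le_filter _ h5))
  | del A' H hH B hB e e'' _ _ h3 h4 h5 =>
    have h17 := hout A' H hH rfl B hB
    obtain ⟨m, hm, hle⟩ := h4.exists_le_succ (hchar _ (by omega) (hcard hB))
    exact not_hasExponents_of_delete_eq hQ b hb hb1 hX hH rfl hB (by omega) h3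
      (d := m) (by omega) (Multiset.mem_of_le h5 hm)

/-- Saito's criterion, the direction that produces a basis. -/
lemma exists_basis_of_det {n : ℕ} {A : Arrangement K n} {Q : MvPolynomial (Fin n) K}
    (hQ : IsDefiningPoly A Q)
    (θ : Fin n → Derivation K (MvPolynomial (Fin n) K) (MvPolynomial (Fin n) K))
    (hθ : ∀ i, θ i ∈ DerModule Q)
    {c : K} (hc : c ≠ 0) (hdet : (Matrix.of fun i j => θ i (X j)).det = C c * Q) :
    ∃ b : Basis (Fin n) (MvPolynomial (Fin n) K) (DerModule Q), ∀ i, (b i :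
      Derivation K (MvPolynomial (Fin n) K) (MvPolynomial (Fin n) K)) = θ i := by
  set M := Matrix.of fun i j => θ i (X j) with hM
  have hQ0 : C c * Q ≠ 0 := mul_ne_zero (C_ne_zero.mpr hc) hQ.ne_zero
  have hind : LinearIndependent (MvPolynomial (Fin n) K)
      fun i => (⟨θ i, hθ i⟩ : DerModule Q) :=
    LinearIndependent.of_comp (DerModule Q).subtype
      (linearIndependent_of_det_ne_zero (hdet ▸ hQ0))
  have hspan : ⊤ ≤ Submodule.span (MvPolynomial (Fin n) K)
      (Set.range fun i => (⟨θ i, hθ i⟩ : DerModule Q)) := by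
    rintro ⟨η, hη⟩ -
    have hdvd (i : Fin n) : Q ∣ (M.updateRow i (coeffMap η)).det := by
      have := hQ.dvd_det (Function.update θ i η) fun k => by
        by_cases hk : k = i
        · subst hk
          simpa using hη
        · simpa [hk] using hθ k
      convert this using 2
      ext k j
      by_cases hk : k = i
      · subst hk
        simp [coeffMap_apply]
      · simp [hk, hM]
    choose q hq using hdvd
    have hcr : ∀ j, (C c * Q) * η (X j) = ∑ i, (M.updateRow i (coeffMap η)).det * θ i (X j) := by
      intro j
      have := congrFun (Matrix.mulVec_cramer Mᵀ (coeffMap η)) j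
      rw [Matrix.det_transpose, hdet] at this
      rw [← coeffMap_apply, ← smul_eq_mul, ← Pi.smul_apply, ← this, Matrix.mulVec, dotProduct]
      refine Finset.sum_congr rfl fun i _ => ?_
      rw [Matrix.cramer_transpose_apply, mul_comm]
      rfl
    have hsum : (⟨η, hη⟩ : DerModule Q) = ∑ i, (C c⁻¹ * q i) • ⟨θ i, hθ i⟩ := by
      refine Subtype.ext (derivation_ext fun j => mul_left_cancel₀ hQ0 ?_)
      simp only [AddSubmonoidClass.coe_finsetSum, Submodule.coe_smul, der_sum_apply]
      rw [hcr, Finset.mul_sum]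
      refine Finset.sum_congr rfl fun i _ => ?_
      have hcc : (C c : MvPolynomial (Fin n) K) * C c⁻¹ = 1 := by
        rw [← C_mul, mul_inv_cancel₀ hc, C_1]
      rw [hq]
      linear_combination (-Q * q i * θ i (X j)) * hcc
    rw [hsum]
    exact Submodule.sum_mem _ fun i _ =>
      Submodule.smul_mem _ _ (Submodule.subset_span (Set.mem_range_self i))
  exact ⟨Basis.mk hind hspan, fun i => by rw [Basis.mk_apply]⟩

end Criterion
section RestrictionCount

variable {K : Type*} [Field K]

theorem IsRestriction.card_eq {n : ℕ} {A : Arrangement K (n + 1)}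
    {H : Submodule K (Fin (n + 1) → K)} {B : Arrangement K n} (h : IsRestriction A H B) :
    B.hyperplanes.card = ((A.hyperplanes.erase H).image fun H' => H ⊓ H').card := by
  obtain ⟨e, he⟩ := h
  rw [he]
  have hcomp : ((A.hyperplanes.erase H).image fun H' =>
      Submodule.map (e : H →ₗ[K] (Fin n → K)) (H'.comap H.subtype)) =
      ((A.hyperplanes.erase H).image fun H' => H ⊓ H').image fun Y =>
        Submodule.map (e : H →ₗ[K] (Fin n → K)) (Y.comap H.subtype) := by
    rw [Finset.image_image]
    refine Finset.image_congr fun H' _ => ?_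
    simp only [Function.comp_apply]
    congr 1
    ext x
    simp
  rw [hcomp, Finset.card_image_of_injOn]
  intro Y hY Z hZ hYZ
  obtain ⟨Y', -, rfl⟩ := Finset.mem_image.mp hY
  obtain ⟨Z', -, rfl⟩ := Finset.mem_image.mp hZ
  have := Submodule.map_injective_of_injective e.injective hYZ
  ext x
  constructor
  · intro hx
    have h2 : (⟨x, hx.1⟩ : H) ∈ (H ⊓ Z').comap H.subtype := this ▸ (by exact hx)
    exact h2
  · intro hx
    have h2 : (⟨x, hx.1⟩ : H) ∈ (H ⊓ Y').comap H.subtype := this ▸ (by exact hx)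
    exact h2

theorem lf_apply {n : ℕ} (v x : Fin n → K) : lf v x = v ⬝ᵥ x := by
  simp [lf, dotProduct]

theorem mem_perp {n : ℕ} {v x : Fin n → K} : x ∈ perp v ↔ v ⬝ᵥ x = 0 := by
  rw [perp, LinearMap.mem_ker, lf_apply]

theorem perp_smul {n : ℕ} {c : K} (hc : c ≠ 0) (v : Fin n → K) : perp (c • v) = perp v := by
  ext x
  simp [mem_perp, hc]

theorem exists_smul_of_cross_eq_zero {u v : Fin 3 → K} (hu : u ≠ 0) (h : u ⨯₃ v = 0) :
    ∃ c : K, v = c • u := by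
  by_contra hc
  push Not at hc
  have hli : LinearIndependent K ![u, v] := by
    rw [LinearIndependent.pair_iff' hu]
    exact fun a ha => hc a ha.symm
  exact crossProduct_ne_zero_iff_linearIndependent.mpr hli h

theorem exists_smul_cross_of_dot_eq_zero {u v w : Fin 3 → K} (h : u ⨯₃ v ≠ 0)
    (hu : w ⬝ᵥ u = 0) (hv : w ⬝ᵥ v = 0) : ∃ c : K, w = c • (u ⨯₃ v) := by
  refine exists_smul_of_cross_eq_zero h ?_
  rw [cross_cross_eq_smul_sub_smul, dotProduct_comm u w, dotProduct_comm v w, hu, hv]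
  simp

theorem perp_eq_perp_iff {u v : Fin 3 → K} (hu : u ≠ 0) (hv : v ≠ 0) :
    perp u = perp v ↔ u ⨯₃ v = 0 := by
  constructor
  · intro h
    by_contra hc
    have key : ∀ x, u ⬝ᵥ x = 0 → v ⬝ᵥ x = 0 := fun x hx => mem_perp.mp (h ▸ mem_perp.mpr hx)
    obtain ⟨c, hc'⟩ := exists_eq_smul_of_ker_le (f := lf u) (g := lf v) (by
      intro x hx
      rw [LinearMap.mem_ker, lf_apply] at hx ⊢
      exact key x hx)
    apply hc
    have : v = c • u := by
      funext j
      have := congrArg (fun f : (Fin 3 → K) →ₗ[K] K => f (Pi.single j 1)) hc'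
      simpa [lf_single] using this
    rw [this]
    simp
  · intro h
    obtain ⟨c, rfl⟩ := exists_smul_of_cross_eq_zero hu h
    rw [perp_smul]
    rintro rfl
    simp at hv

theorem perp_inf_perp {u v p : Fin 3 → K} (h : u ⨯₃ v ≠ 0) (hp : p ≠ 0)
    (hu : u ⬝ᵥ p = 0) (hv : v ⬝ᵥ p = 0) : perp u ⊓ perp v = Submodule.span K {p} := by
  have key : ∀ x, u ⬝ᵥ x = 0 → v ⬝ᵥ x = 0 → ∃ c : K, x = c • (u ⨯₃ v) := fun x hx hx' =>
    exists_smul_cross_of_dot_eq_zero h (by rwa [dotProduct_comm]) (by rwa [dotProduct_comm])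
  apply le_antisymm
  · rintro x ⟨hx, hx'⟩
    obtain ⟨c, rfl⟩ := key x (mem_perp.mp hx) (mem_perp.mp hx')
    obtain ⟨d, hd⟩ := key p hu hv
    have hd0 : d ≠ 0 := by
      rintro rfl
      simp at hd
      exact hp hd
    refine Submodule.mem_span_singleton.mpr ⟨c * d⁻¹, ?_⟩
    rw [hd, smul_smul, mul_assoc, inv_mul_cancel₀ hd0, mul_one]
  · rw [Submodule.span_singleton_le_iff_mem]
    exact ⟨mem_perp.mpr hu, mem_perp.mpr hv⟩

end RestrictionCount

section Tables

/-- Three natural numbers, read modulo `251` as a vector of `𝔽₂₅₁³`. -/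
abbrev NatVec := ℕ × ℕ × ℕ

def toVec (v : NatVec) : Fin 3 → ZMod 251 := ![v.1, v.2.1, v.2.2]

def natDot (a b : NatVec) : ℕ := a.1 * b.1 + (a.2.1 * b.2.1 + a.2.2 * b.2.2)

def natCross (a b : NatVec) : NatVec :=
  ((a.2.1 * b.2.2 + 250 * (a.2.2 * b.2.1)) % 251, (a.2.2 * b.1 + 250 * (a.1 * b.2.2)) % 251,
    (a.1 * b.2.1 + 250 * (a.2.1 * b.1)) % 251)

def isZero (a : NatVec) : Bool := (a.1 % 251 + (a.2.1 % 251 + a.2.2 % 251)) == 0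

def isOrth (a b : NatVec) : Bool := natDot a b % 251 == 0

def allPairs {α : Type*} (P : α → α → Bool) : List α → Bool
  | [] => true
  | a :: l => l.all (P a) && allPairs P l

def normals : List (ℕ × ℕ × ℕ) := [
  (1, 0, 0), (0, 1, 0), (0, 0, 1), (1, 102, 0), (1, 134, 0), (0, 1, 1), (21, 32, 0), (1, 102, 102),
  (1, 32, 0), (1, 134, 134), (21, 21, 0), (21, 32, 32), (1, 32, 32), (1, 134, 102), (21, 21, 21),
  (21, 53, 32), (1, 134, 32), (21, 21, 1), (21, 53, 21), (53, 53, 32), (21, 21, 20), (21, 33, 1),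
  (53, 53, 21), (21, 52, 20), (21, 33, 32), (21, 52, 32), (53, 42, 21)]

def weightedPoints : List (ℕ × ℕ × ℕ × ℕ) := [
  (2, 1, 250, 240), (2, 1, 250, 220), (2, 1, 250, 150), (1, 1, 250, 133), (2, 1, 250, 119),
  (1, 1, 250, 118), (2, 1, 250, 12), (2, 1, 250, 1), (6, 1, 250, 0), (2, 1, 239, 231),
  (2, 1, 239, 11), (1, 1, 236, 133), (2, 1, 231, 169), (2, 1, 231, 137), (2, 1, 230, 170),
  (2, 1, 230, 21), (2, 1, 219, 181), (2, 1, 219, 170), (2, 1, 219, 169), (2, 1, 219, 150),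
  (2, 1, 219, 149), (2, 1, 219, 138), (2, 1, 219, 32), (2, 1, 219, 31), (2, 1, 219, 20),
  (2, 1, 219, 0), (1, 1, 184, 0), (2, 1, 149, 231), (2, 1, 149, 220), (2, 1, 149, 219),
  (2, 1, 149, 113), (2, 1, 149, 102), (2, 1, 149, 101), (2, 1, 149, 82), (2, 1, 149, 81),
  (2, 1, 149, 70), (2, 1, 149, 0), (2, 1, 138, 230), (2, 1, 138, 81), (2, 1, 137, 114),
  (2, 1, 137, 82), (1, 1, 132, 118), (2, 1, 129, 240), (2, 1, 129, 20), (2, 1, 118, 250),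
  (2, 1, 118, 239), (1, 1, 118, 133), (2, 1, 118, 132), (1, 1, 118, 118), (2, 1, 118, 101),
  (2, 1, 118, 31), (2, 1, 118, 11), (6, 1, 118, 0), (1, 1, 117, 135), (6, 1, 117, 134),
  (1, 1, 117, 133), (2, 1, 117, 114), (2, 1, 117, 102), (2, 1, 117, 32), (2, 1, 117, 21),
  (2, 1, 117, 1), (2, 1, 117, 0), (1, 1, 116, 135), (2, 1, 106, 113), (2, 1, 106, 12),
  (2, 1, 72, 224), (2, 1, 72, 0), (2, 1, 45, 27), (2, 1, 45, 0), (2, 1, 11, 239), (2, 1, 11, 138),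
  (1, 1, 1, 116), (2, 1, 0, 250), (2, 1, 0, 230), (2, 1, 0, 219), (2, 1, 0, 149), (2, 1, 0, 137),
  (1, 1, 0, 118), (6, 1, 0, 117), (1, 1, 0, 116), (2, 1, 0, 0), (6, 0, 1, 250), (1, 0, 1, 249),
  (2, 0, 1, 230), (2, 0, 1, 218), (2, 0, 1, 148), (2, 0, 1, 137), (2, 0, 1, 117), (2, 0, 1, 116),
  (1, 0, 1, 0), (6, 0, 0, 1)]

def pointsOn (a : NatVec) : List (ℕ × ℕ × ℕ × ℕ) := weightedPoints.filter fun q => isOrth a q.2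

/-- Sum of the weights of the listed points on the line `a`. -/
def weightOn (a : NatVec) : List (ℕ × ℕ × ℕ × ℕ) → ℕ
  | [] => 0
  | q :: l => bif isOrth a q.2 then q.1 + weightOn a l else weightOn a l

theorem pairwise_of_allPairs {α : Type*} {P : α → α → Bool} {l : List α}
    (h : allPairs P l = true) : l.Pairwise fun a b => P a b = true := by
  induction l with
  | nil => exact List.Pairwise.nil
  | cons a l ih =>
    simp only [allPairs, Bool.and_eq_true, List.all_eq_true] at h
    exact List.Pairwise.cons h.1 (ih h.2)

theorem natCast_eq_zero_iff (n : ℕ) : (n : ZMod 251) = 0 ↔ n % 251 = 0 := by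
  rw [ZMod.natCast_eq_zero_iff, Nat.dvd_iff_mod_eq_zero]

theorem toVec_dotProduct (a b : NatVec) : toVec a ⬝ᵥ toVec b = (natDot a b : ZMod 251) := by
  simp [toVec, natDot, dotProduct, Fin.sum_univ_three, add_assoc]

theorem isOrth_iff {a b : NatVec} : isOrth a b = true ↔ toVec a ⬝ᵥ toVec b = 0 := by
  rw [toVec_dotProduct, natCast_eq_zero_iff, isOrth, beq_iff_eq]

theorem toVec_cross (a b : NatVec) : toVec a ⨯₃ toVec b = toVec (natCross a b) := by
  have h : ((250 : ℕ) : ZMod 251) = -1 := by decide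
  simp only [cross_apply, toVec, natCross, ZMod.natCast_mod, Nat.cast_add, Nat.cast_mul, h]
  simp [sub_eq_add_neg]

theorem isZero_iff {a : NatVec} : isZero a = true ↔ toVec a = 0 := by
  have h : toVec a = 0 ↔ (a.1 : ZMod 251) = 0 ∧ (a.2.1 : ZMod 251) = 0 ∧
      (a.2.2 : ZMod 251) = 0 := by
    simp [toVec, funext_iff, Fin.forall_fin_succ]
  rw [h, natCast_eq_zero_iff, natCast_eq_zero_iff, natCast_eq_zero_iff, isZero, beq_iff_eq]
  omega

theorem normals_ne_zero {v : NatVec} (hv : v ∈ normals) : toVec v ≠ 0 := by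
  have h : (normals.all fun v => !isZero v) = true := by decide +kernel
  have := List.all_eq_true.mp h v hv
  rw [Ne, ← isZero_iff]
  simpa using this

theorem weightedPoints_ne_zero {q : ℕ × ℕ × ℕ × ℕ} (hq : q ∈ weightedPoints) :
    toVec q.2 ≠ 0 := by
  have h : (weightedPoints.all fun q => !isZero q.2) = true := by decide +kernel
  have := List.all_eq_true.mp h q hq
  rw [Ne, ← isZero_iff]
  simpa using this

theorem normals_pairwise : normals.Pairwise fun a b => toVec a ⨯₃ toVec b ≠ 0 := by
  have h : allPairs (fun a b => !isZero (natCross a b)) normals = true := by decide +kernel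
  refine (pairwise_of_allPairs h).imp fun {a b} hab => ?_
  rw [toVec_cross, Ne, ← isZero_iff]
  simpa using hab

theorem normals_cross_ne_zero {a b : NatVec} (ha : a ∈ normals) (hb : b ∈ normals)
    (hab : a ≠ b) : toVec a ⨯₃ toVec b ≠ 0 := by
  have : Std.Symm fun a b => toVec a ⨯₃ toVec b ≠ 0 :=
    ⟨fun a b h h' => h (by rw [← cross_anticomm, h', neg_zero])⟩
  exact normals_pairwise.forall ha hb hab

theorem exists_mem_weightedPoints {a b : NatVec} (ha : a ∈ normals) (hb : b ∈ normals)
    (hab : a ≠ b) :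
    ∃ q ∈ weightedPoints, isOrth a q.2 = true ∧ isOrth b q.2 = true := by
  have h : allPairs (fun a b => weightedPoints.any fun q => isOrth a q.2 && isOrth b q.2)
      normals = true := by decide +kernel
  have h' : normals.Pairwise fun a b =>
      ∃ q ∈ weightedPoints, isOrth a q.2 = true ∧ isOrth b q.2 = true :=
    (pairwise_of_allPairs h).imp fun {a b} hab => by simpa using hab
  have : Std.Symm fun a b =>
      ∃ q ∈ weightedPoints, isOrth a q.2 = true ∧ isOrth b q.2 = true :=
    ⟨fun a b ⟨q, hq, h1, h2⟩ => ⟨q, hq, h2, h1⟩⟩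
  exact h'.forall ha hb hab

theorem weight_eq {q : ℕ × ℕ × ℕ × ℕ} (hq : q ∈ weightedPoints) :
    (normals.filter fun v => isOrth v q.2).tail.length = q.1 := by
  have h : (weightedPoints.all fun q =>
      (normals.filter fun v => isOrth v q.2).tail.length == q.1) = true := by decide +kernel
  simpa using List.all_eq_true.mp h q hq

theorem length_pointsOn_le {v : NatVec} (hv : v ∈ normals) : (pointsOn v).length ≤ 11 := by
  have h : (normals.all fun v => Nat.ble (pointsOn v).length 11) = true := by decide +kernel
  exact Nat.le_of_ble_eq_true (List.all_eq_true.mp h v hv)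

theorem weight_le {q : ℕ × ℕ × ℕ × ℕ} (hq : q ∈ weightedPoints) : q.1 ≤ 10 := by
  have h : (weightedPoints.all fun q => Nat.ble q.1 10) = true := by decide +kernel
  exact Nat.le_of_ble_eq_true (List.all_eq_true.mp h q hq)

set_option maxHeartbeats 4000000 in
theorem weightedPoints_pairwise : weightedPoints.Pairwise fun q r =>
    toVec q.2 ⨯₃ toVec r.2 ≠ 0 ∧
      ((∃ v ∈ normals, isOrth v q.2 = true ∧ isOrth v r.2 = true) ∨
        weightOn (natCross q.2 r.2) weightedPoints ≤ 10) := by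
  have h : allPairs (fun q r => !isZero (natCross q.2 r.2) &&
      ((normals.any fun v => isOrth v q.2 && isOrth v r.2) ||
        Nat.ble (weightOn (natCross q.2 r.2) weightedPoints) 10)) weightedPoints = true := by
    decide +kernel
  refine (pairwise_of_allPairs h).imp fun {q r} hqr => ?_
  rw [Bool.and_eq_true, Bool.or_eq_true] at hqr
  refine ⟨?_, hqr.2.imp (fun h => by simpa using h) Nat.le_of_ble_eq_true⟩
  rw [toVec_cross, Ne, ← isZero_iff]
  simpa using hqr.1

theorem length_normals : normals.length = 27 := rfl

attribute [irreducible] normals weightedPoints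

end Tables

section Realization

local notation "F" => ZMod 251

/-- The arrangement of 27 planes in `𝔽₂₅₁³` with the listed normal vectors. -/
noncomputable def realization : Arrangement F 3 :=
  ⟨(normals.map fun v => perp (toVec v)).toFinset, by
    intro H hH
    obtain ⟨v, hv, rfl⟩ := List.mem_map.mp (List.mem_toFinset.mp hH)
    exact ⟨lf (toVec v), lf_ne_zero (normals_ne_zero hv), rfl⟩⟩

theorem mem_realization {H : Submodule F (Fin 3 → F)} :
    H ∈ realization.hyperplanes ↔ ∃ v ∈ normals, perp (toVec v) = H := by
  simp only [realization, List.mem_toFinset, List.mem_map]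

theorem perp_toVec_injOn {a b : NatVec} (ha : a ∈ normals) (hb : b ∈ normals)
    (h : perp (toVec a) = perp (toVec b)) : a = b := by
  by_contra hab
  exact normals_cross_ne_zero ha hb hab
    ((perp_eq_perp_iff (normals_ne_zero ha) (normals_ne_zero hb)).mp h)

theorem normals_nodup : normals.Nodup :=
  normals_pairwise.imp fun {a b} h hab => h (by rw [hab, cross_self])

theorem card_realization : realization.hyperplanes.card = 27 := by
  rw [realization, List.toFinset_card_of_nodup, List.length_map, length_normals]
  exact normals_nodup.map_on fun a ha b hb h => perp_toVec_injOn ha hb h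

theorem card_restriction_realization {H : Submodule F (Fin 3 → F)}
    (hH : H ∈ realization.hyperplanes) {B : Arrangement F 2}
    (hB : IsRestriction realization H B) :
    0 < B.hyperplanes.card ∧ B.hyperplanes.card ≤ 11 := by
  rw [hB.card_eq]
  constructor
  · rw [Finset.card_pos, Finset.image_nonempty, ← Finset.card_pos,
      Finset.card_erase_of_mem hH, card_realization]
    norm_num
  · obtain ⟨v, hv, rfl⟩ := mem_realization.mp hH
    calc _ ≤ ((pointsOn v).map fun q => Submodule.span F {toVec q.2}).toFinset.card := by
          refine Finset.card_le_card fun Y hY => ?_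
          obtain ⟨H', hH', rfl⟩ := Finset.mem_image.mp hY
          obtain ⟨hne, hmem⟩ := Finset.mem_erase.mp hH'
          obtain ⟨w, hw, rfl⟩ := mem_realization.mp hmem
          have hvw : v ≠ w := by rintro rfl; exact hne rfl
          obtain ⟨q, hq, h1, h2⟩ := exists_mem_weightedPoints hv hw hvw
          rw [List.mem_toFinset, List.mem_map]
          exact ⟨q, List.mem_filter.mpr ⟨hq, h1⟩, (perp_inf_perp (normals_cross_ne_zero hv hw hvw)
            (weightedPoints_ne_zero hq) (isOrth_iff.mp h1) (isOrth_iff.mp h2)).symm⟩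
      _ ≤ (pointsOn v).length := (List.toFinset_card_le _).trans (by rw [List.length_map])
      _ ≤ 11 := length_pointsOn_le hv

theorem weightOn_eq (a : NatVec) (l : List (ℕ × ℕ × ℕ × ℕ)) :
    weightOn a l = ((l.filter fun q => isOrth a q.2).map Prod.fst).sum := by
  induction l with
  | nil => rfl
  | cons q l ih =>
    rw [weightOn]
    cases h : isOrth a q.2 <;> simp [h, ih]

/-- A plane outside the arrangement meets it in points of total weight at most `10`. -/
theorem sum_weight_le {u : Fin 3 → F} (hu : u ≠ 0) (hout : perp u ∉ realization.hyperplanes) :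
    ((weightedPoints.filter fun q => decide (u ⬝ᵥ toVec q.2 = 0)).map Prod.fst).sum ≤ 10 := by
  generalize hl : weightedPoints.filter (fun q => decide (u ⬝ᵥ toVec q.2 = 0)) = m
  rcases m with _ | ⟨q, _ | ⟨r, l⟩⟩
  · simp
  · have : q ∈ weightedPoints :=
      List.mem_of_mem_filter (by rw [hl]; exact List.mem_singleton_self q)
    simpa using weight_le this
  · rw [← hl]
    have hpair := weightedPoints_pairwise.sublist
      ((List.filter_sublist (p := fun q => decide (u ⬝ᵥ toVec q.2 = 0))))
    have huq : u ⬝ᵥ toVec q.2 = 0 := by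
      have : q ∈ weightedPoints.filter fun q => decide (u ⬝ᵥ toVec q.2 = 0) := by rw [hl]; simp
      simpa using (List.mem_filter.mp this).2
    have hur : u ⬝ᵥ toVec r.2 = 0 := by
      have : r ∈ weightedPoints.filter fun q => decide (u ⬝ᵥ toVec q.2 = 0) := by rw [hl]; simp
      simpa using (List.mem_filter.mp this).2
    rw [hl] at hpair
    obtain ⟨hqr, h⟩ := (List.pairwise_cons.mp hpair).1 r (by simp)
    obtain ⟨c, hc⟩ := exists_smul_cross_of_dot_eq_zero hqr huq hur
    have hc0 : c ≠ 0 := by rintro rfl; exact hu (by rw [hc, zero_smul])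
    rcases h with ⟨v, hv, h1, h2⟩ | h
    · exfalso
      obtain ⟨d, hd⟩ := exists_smul_cross_of_dot_eq_zero hqr (isOrth_iff.mp h1) (isOrth_iff.mp h2)
      refine hout (mem_realization.mpr ⟨v, hv, ?_⟩)
      rw [perp_eq_perp_iff (normals_ne_zero hv) hu, hc, hd]
      simp
    · rw [weightOn_eq] at h
      convert h using 5
      rename_i s
      rw [Bool.eq_iff_iff, isOrth_iff, ← toVec_cross, decide_eq_true_iff, hc]
      simp [hc0]

theorem sum_toFinset_le {α : Type*} [DecidableEq α] (l : List α) (f : α → ℕ) :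
    ∑ x ∈ l.toFinset, f x ≤ (l.map f).sum := by
  induction l with
  | nil => simp
  | cons a l ih =>
    rw [List.toFinset_cons, List.map_cons, List.sum_cons]
    by_cases ha : a ∈ l.toFinset
    · rw [Finset.insert_eq_of_mem ha]
      exact ih.trans (Nat.le_add_left _ _)
    · rw [Finset.sum_insert ha]
      exact Nat.add_le_add_left ih _

theorem mem_tail_or_mem_tail {α : Type*} {l : List α} {a b : α} (ha : a ∈ l) (hb : b ∈ l)
    (hab : a ≠ b) : a ∈ l.tail ∨ b ∈ l.tail := by
  cases l with
  | nil => simp at ha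
  | cons c l =>
    rw [List.tail_cons]
    rcases List.mem_cons.mp ha with rfl | ha
    · rcases List.mem_cons.mp hb with rfl | hb
      · exact absurd rfl hab
      · exact Or.inr hb
    · exact Or.inl ha

theorem card_restriction_extension {A : Arrangement F 3} {H : Submodule F (Fin 3 → F)}
    (hH : H ∈ A.hyperplanes) (hA : A.delete H = realization) {B : Arrangement F 2}
    (hB : IsRestriction A H B) : 17 ≤ B.hyperplanes.card := by
  have herase : A.hyperplanes.erase H = realization.hyperplanes := by rw [← hA]; rfl
  have hout : H ∉ realization.hyperplanes := by rw [← herase]; simp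
  obtain ⟨f, hf, rfl⟩ := A.isHyp H hH
  obtain ⟨u, rfl⟩ : ∃ u, f = lf u := by
    refine ⟨fun j => f (Pi.single j 1), LinearMap.pi_ext' fun j => ?_⟩
    ext
    simp [lf_single]
  have hu : u ≠ 0 := by rintro rfl; exact hf (by ext; simp [lf])
  change perp u ∉ _ at hout
  rw [hB.card_eq, herase]
  change 17 ≤ (Finset.image (fun H' => perp u ⊓ H') _).card
  set pts := weightedPoints.filter fun q => decide (u ⬝ᵥ toVec q.2 = 0) with hpts
  set on : ℕ × ℕ × ℕ × ℕ → List NatVec := fun q => normals.filter fun v => isOrth v q.2 with hon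
  set T : Finset NatVec := pts.toFinset.biUnion fun q => (on q).tail.toFinset with hT
  have hTcard : T.card ≤ 10 := by
    calc T.card ≤ ∑ q ∈ pts.toFinset, (on q).tail.toFinset.card := Finset.card_biUnion_le
      _ ≤ ∑ q ∈ pts.toFinset, q.1 := by
          refine Finset.sum_le_sum fun q hq => ?_
          rw [← weight_eq (List.mem_of_mem_filter (List.mem_toFinset.mp hq))]
          exact List.toFinset_card_le _
      _ ≤ (pts.map Prod.fst).sum := sum_toFinset_le _ _
      _ ≤ 10 := sum_weight_le hu hout
  have hinj : Set.InjOn (fun v => perp u ⊓ perp (toVec v)) ↑(normals.toFinset \ T) := by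
    intro a ha b hb hab
    by_contra hne
    rw [Finset.mem_coe, Finset.mem_sdiff, List.mem_toFinset] at ha hb
    obtain ⟨q, hq, h1, h2⟩ := exists_mem_weightedPoints ha.1 hb.1 hne
    have hua : u ⨯₃ toVec a ≠ 0 := fun h => hout (mem_realization.mpr
      ⟨a, ha.1, ((perp_eq_perp_iff hu (normals_ne_zero ha.1)).mpr h).symm⟩)
    have hx : u ⨯₃ toVec a ∈ perp u ⊓ perp (toVec a) :=
      ⟨mem_perp.mpr (dot_self_cross _ _), mem_perp.mpr (dot_cross_self _ _)⟩
    have hxb : u ⨯₃ toVec a ∈ perp (toVec b) := by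
      have hab' : perp u ⊓ perp (toVec a) = perp u ⊓ perp (toVec b) := hab
      rw [hab'] at hx
      exact hx.2
    have hspan := perp_inf_perp (normals_cross_ne_zero ha.1 hb.1 hne)
      (weightedPoints_ne_zero hq) (isOrth_iff.mp h1) (isOrth_iff.mp h2)
    have hxab : u ⨯₃ toVec a ∈ perp (toVec a) ⊓ perp (toVec b) := ⟨hx.2, hxb⟩
    rw [hspan] at hxab
    obtain ⟨c, hc⟩ := Submodule.mem_span_singleton.mp hxab
    have hc0 : c ≠ 0 := by rintro rfl; exact hua (by rw [← hc, zero_smul])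
    have huq : u ⬝ᵥ toVec q.2 = 0 := by
      have := mem_perp.mp hx.1
      rw [← hc, dotProduct_smul, smul_eq_mul] at this
      exact (mul_eq_zero.mp this).resolve_left hc0
    have hqpts : q ∈ pts.toFinset :=
      List.mem_toFinset.mpr (List.mem_filter.mpr ⟨hq, by simpa using huq⟩)
    rcases mem_tail_or_mem_tail (List.mem_filter.mpr ⟨ha.1, h1⟩ : a ∈ on q)
      (List.mem_filter.mpr ⟨hb.1, h2⟩ : b ∈ on q) hne with h | h
    · exact ha.2 (Finset.mem_biUnion.mpr ⟨q, hqpts, List.mem_toFinset.mpr h⟩)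
    · exact hb.2 (Finset.mem_biUnion.mpr ⟨q, hqpts, List.mem_toFinset.mpr h⟩)
  have hcard : 27 - 10 ≤ (normals.toFinset \ T).card := by
    have := Finset.le_card_sdiff T normals.toFinset
    rw [List.toFinset_card_of_nodup normals_nodup, length_normals] at this
    exact (Nat.sub_le_sub_left hTcard _).trans this
  rw [← Finset.card_image_of_injOn hinj] at hcard
  refine hcard.trans (Finset.card_le_card fun Y hY => ?_)
  obtain ⟨v, hv, rfl⟩ := Finset.mem_image.mp hY
  refine Finset.mem_image.mpr ⟨perp (toVec v), mem_realization.mpr ⟨v, ?_, rfl⟩, rfl⟩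
  exact List.mem_toFinset.mp (Finset.mem_sdiff.mp hv).1

end Realization

section Interpolation

variable {K : Type*} [Field K]

theorem linPoly_dvd_of_points {p : MvPolynomial (Fin 3) K} {d : ℕ} (hp : p.IsHomogeneous d)
    {v u w : Fin 3 → K} (hv : v ≠ 0) (hu : v ⬝ᵥ u = 0) (hw : v ⬝ᵥ w = 0) (huw : u ⨯₃ w ≠ 0)
    (T : Finset K) (hT : d < T.card) (h : ∀ s ∈ T, eval (s • u + w) p = 0) :
    linPoly (lf v) ∣ p := by
  have hli : LinearIndependent K ![u, w] := crossProduct_ne_zero_iff_linearIndependent.mp huw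
  let g : (Fin 2 → K) →ₗ[K] LinearMap.ker (lf v) := LinearMap.codRestrict _
    (Fintype.linearCombination K ![u, w]) fun x => by
      simp [Fintype.linearCombination_apply, Fin.sum_univ_two, lf_apply, hu, hw]
  have hg (x : Fin 2 → K) : (g x : Fin 3 → K) = x 0 • u + x 1 • w := by
    simp [g, Fintype.linearCombination_apply, Fin.sum_univ_two]
  have hginj : Function.Injective g := by
    refine LinearMap.ker_eq_bot.mp (LinearMap.ker_eq_bot'.mpr fun x hx => ?_)
    have := LinearIndependent.pair_iff.mp hli (x 0) (x 1) (by rw [← hg, hx]; rfl)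
    funext j
    fin_cases j
    · exact this.1
    · exact this.2
  have hrank : finrank K (Fin 2 → K) = finrank K (LinearMap.ker (lf v)) := by
    have h1 := Module.Dual.finrank_ker_add_one_of_ne_zero (lf_ne_zero hv)
    rw [finrank_fin_fun] at h1 ⊢
    omega
  have hne (s : K) : (![1, -s] : Fin 2 → K) ≠ 0 := fun h => one_ne_zero (congrFun h 0)
  let B : Arrangement K 2 := ⟨T.image fun s => perp ![1, -s], by
    intro H hH
    obtain ⟨s, -, rfl⟩ := Finset.mem_image.mp hH
    exact ⟨_, lf_ne_zero (hne s), rfl⟩⟩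
  have hmem {s : K} {x : Fin 2 → K} : x ∈ perp ![1, -s] ↔ x 0 = s * x 1 := by
    rw [mem_perp]
    simp [dotProduct, Fin.sum_univ_two, add_neg_eq_zero]
  refine linPoly_dvd_of_vanishing hp (lf_ne_zero hv)
    (LinearEquiv.ofInjectiveOfFinrankEq g hginj hrank) B ?_ ?_
  · rw [Finset.card_image_of_injective]
    · exact hT
    · intro s t hst
      have hs : (![s, 1] : Fin 2 → K) ∈ perp ![1, -s] := hmem.mpr (by simp)
      have hst' : perp (![1, -s] : Fin 2 → K) = perp ![1, -t] := hst
      rw [hst', hmem] at hs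
      simpa using hs
  · intro H hH x hx
    obtain ⟨s, hs, rfl⟩ := Finset.mem_image.mp hH
    have hx' := hmem.mp hx
    have hgx : (g x : Fin 3 → K) = fun j => x 1 * (s • u + w) j := by
      rw [hg, hx']
      funext j
      simp
      ring
    have h1 := aeval_mul_of_isHomogeneous hp (x 1) (s • u + w)
    rw [aeval_eq_eval, aeval_eq_eval, h s hs, mul_zero] at h1
    change eval (g x : Fin 3 → K) p = 0
    rw [hgx]
    exact h1

end Interpolation

section CoefficientTables

/-- The homogeneous polynomial in `y, z` whose coefficients are listed by increasing powers
of `y`. -/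
def binaryForm {R : Type*} [CommSemiring R] (y z : R) : List ℕ → R
  | [] => 0
  | c :: l => c * z ^ l.length + y * binaryForm y z l

/-- The homogeneous polynomial in `x, y, z` whose coefficients as binary forms in `y, z` are
listed by increasing powers of `x`. -/
def ternaryForm {R : Type*} [CommSemiring R] (x y z : R) : List (List ℕ) → R
  | [] => 0
  | r :: l => binaryForm y z r + x * ternaryForm x y z l

def natBinaryForm (y z : ℕ) : List ℕ → ℕ
  | [] => 0
  | c :: l => Nat.add (Nat.mul c (Nat.pow z l.length)) (Nat.mul y (natBinaryForm y z l))

def natTernaryForm (x y z : ℕ) : List (List ℕ) → ℕ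
  | [] => 0
  | r :: l => Nat.add (natBinaryForm y z r) (Nat.mul x (natTernaryForm x y z l))

/-- The rows have lengths `l.length, …, 2, 1`. -/
def isTriangular : List (List ℕ) → Bool
  | [] => true
  | r :: l => r.length == l.length + 1 && isTriangular l

theorem natCast_natBinaryForm {R : Type*} [CommSemiring R] (y z : ℕ) (l : List ℕ) :
    (natBinaryForm y z l : R) = binaryForm (y : R) z l := by
  induction l with
  | nil => simp [natBinaryForm, binaryForm]
  | cons c l ih =>
    rw [binaryForm, ← ih, natBinaryForm]
    simp

theorem natCast_natTernaryForm {R : Type*} [CommSemiring R] (x y z : ℕ) (l : List (List ℕ)) :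
    (natTernaryForm x y z l : R) = ternaryForm (x : R) y z l := by
  induction l with
  | nil => simp [natTernaryForm, ternaryForm]
  | cons c l ih =>
    rw [ternaryForm, ← ih, natTernaryForm, ← natCast_natBinaryForm]
    simp

theorem map_binaryForm {R R' : Type*} [CommSemiring R] [CommSemiring R'] (f : R →+* R')
    (y z : R) (l : List ℕ) : f (binaryForm y z l) = binaryForm (f y) (f z) l := by
  induction l with
  | nil => simp [binaryForm]
  | cons c l ih => simp [binaryForm, ih]

theorem map_ternaryForm {R R' : Type*} [CommSemiring R] [CommSemiring R'] (f : R →+* R')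
    (x y z : R) (l : List (List ℕ)) :
    f (ternaryForm x y z l) = ternaryForm (f x) (f y) (f z) l := by
  induction l with
  | nil => simp [ternaryForm]
  | cons c l ih => simp [ternaryForm, ih, map_binaryForm]

variable {K : Type*} [Field K]

theorem binaryForm_isHomogeneous {c : ℕ} {l : List ℕ} :
    (binaryForm (X 1 : MvPolynomial (Fin 3) K) (X 2) (c :: l)).IsHomogeneous l.length := by
  induction l generalizing c with
  | nil => simpa [binaryForm] using isHomogeneous_C (Fin 3) (c : K)
  | cons b l ih =>
    rw [binaryForm]
    refine IsHomogeneous.add ?_ ?_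
    · simpa using (isHomogeneous_C (Fin 3) (c : K)).mul
        (isHomogeneous_X_pow (2 : Fin 3) (b :: l).length)
    · simpa [add_comm] using (isHomogeneous_X K (1 : Fin 3)).mul ih

theorem ternaryForm_isHomogeneous {r : List ℕ} {l : List (List ℕ)}
    (h : isTriangular (r :: l) = true) :
    (ternaryForm (X 0 : MvPolynomial (Fin 3) K) (X 1) (X 2) (r :: l)).IsHomogeneous l.length := by
  induction l generalizing r with
  | nil =>
    rw [isTriangular, Bool.and_eq_true, beq_iff_eq] at h
    obtain _ | ⟨c, r⟩ := r
    · simp at h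
    have hr : r.length = 0 := by simpa using h.1
    have := binaryForm_isHomogeneous (K := K) (c := c) (l := r)
    rw [hr] at this
    simpa [ternaryForm] using this
  | cons s l ih =>
    rw [isTriangular, Bool.and_eq_true, beq_iff_eq] at h
    obtain _ | ⟨c, r⟩ := r
    · simp at h
    have hr : r.length = (s :: l).length := by simpa using h.1
    have := binaryForm_isHomogeneous (K := K) (c := c) (l := r)
    rw [hr] at this
    rw [ternaryForm]
    refine this.add ?_
    simpa [add_comm] using (isHomogeneous_X K (0 : Fin 3)).mul (ih h.2)

end CoefficientTables

section Basis

local notation "F" => ZMod 251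
local notation "S" => MvPolynomial (Fin 3) F
local notation "Dr" => Derivation F (MvPolynomial (Fin 3) F) (MvPolynomial (Fin 3) F)

def secondY : List (List ℕ) := [
  [0, 0, 0, 0, 0, 189, 204, 246, 161, 146, 103], [0, 0, 0, 0, 176, 45, 81, 197, 181, 109],
  [0, 0, 0, 216, 164, 91, 183, 137, 176], [0, 0, 216, 220, 192, 120, 114, 158],
  [0, 176, 133, 105, 217, 5, 131], [189, 99, 26, 116, 49, 75], [114, 150, 149, 31, 152],
  [42, 244, 242, 186], [218, 120, 1], [104, 36], [1]]

def secondZ : List (List ℕ) := [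
  [138, 201, 205, 73, 159, 123, 14, 218, 87, 189, 88],
  [164, 111, 115, 193, 41, 106, 85, 197, 13, 226], [79, 175, 51, 174, 193, 231, 250, 220, 55],
  [227, 207, 72, 13, 129, 13, 112, 32], [195, 93, 247, 211, 114, 211, 154],
  [26, 160, 249, 167, 127, 101], [234, 30, 226, 141, 196], [146, 171, 139, 9], [99, 14, 14],
  [183, 115], [1]]

def thirdY : List (List ℕ) := [
  [0, 0, 0, 0, 0, 135, 242, 66, 33, 0, 203, 116, 1, 117, 134],
  [0, 0, 0, 0, 54, 215, 236, 185, 219, 210, 5, 113, 19, 175],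
  [0, 0, 0, 226, 146, 216, 250, 125, 104, 93, 161, 59, 185],
  [0, 0, 226, 175, 171, 89, 244, 56, 152, 118, 6, 163],
  [0, 54, 153, 248, 142, 47, 161, 8, 31, 206, 143],
  [135, 219, 86, 204, 186, 37, 186, 232, 140, 202], [68, 123, 218, 135, 83, 70, 40, 157, 109],
  [160, 48, 134, 132, 134, 7, 149, 100], [134, 13, 144, 115, 240, 47, 70],
  [39, 77, 164, 53, 98, 200], [68, 247, 57, 215, 86], [8, 199, 131, 191], [192, 74, 133], [81, 81],
  [1]]

def thirdZ : List (List ℕ) := [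
  [179, 122, 120, 114, 235, 152, 0, 245, 20, 112, 32, 205, 155, 133, 19],
  [114, 214, 248, 87, 70, 223, 18, 231, 166, 66, 189, 61, 116, 153],
  [127, 244, 245, 60, 228, 116, 58, 190, 32, 214, 150, 168, 28],
  [53, 143, 181, 52, 124, 74, 76, 224, 54, 11, 150, 187],
  [67, 140, 187, 130, 121, 129, 115, 179, 30, 32, 157],
  [161, 77, 26, 163, 250, 32, 212, 102, 49, 234], [33, 119, 248, 152, 227, 91, 131, 158, 165],
  [212, 35, 81, 198, 216, 237, 0, 0], [162, 99, 120, 187, 205, 184, 145], [29, 4, 89, 143, 0, 0],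
  [0, 0, 0, 0, 0], [0, 0, 0, 0], [0, 0, 0], [0, 0], [1]]

noncomputable def form (l : List (List ℕ)) : S := ternaryForm (X 0) (X 1) (X 2) l

/-- The derivation `y g ∂/∂y + z h ∂/∂z`. -/
noncomputable def tableDer (g h : List (List ℕ)) : Dr :=
  mkDerivation F ![0, X 1 * form g, X 2 * form h]

/-- Two vectors spanning the plane with normal vector `v`. -/
def planeBasis (v : NatVec) : NatVec × NatVec :=
  bif v.1 == 0 then ((1, 0, 0), (0, 250 * v.2.2 % 251, v.2.1))
  else ((250 * v.2.1 % 251, v.1, 0), (250 * v.2.2 % 251, 0, v.1))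

def planePoint (v : NatVec) (s : ℕ) : NatVec :=
  let B := planeBasis v
  ((s * B.1.1 + B.2.1) % 251, (s * B.1.2.1 + B.2.2.1) % 251, (s * B.1.2.2 + B.2.2.2) % 251)

/-- The value at `p` of the vector field `tableDer g h`. -/
def tableVal (g h : List (List ℕ)) (p : NatVec) : NatVec :=
  (0, p.2.1 * natTernaryForm p.1 p.2.1 p.2.2 g % 251,
    p.2.2 * natTernaryForm p.1 p.2.1 p.2.2 h % 251)

def isTangent (g h : List (List ℕ)) (n : ℕ) (v : NatVec) : Bool :=
  (List.range n).all fun s => isOrth v (tableVal g h (planePoint v s))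

theorem planeBasis_spec {v : NatVec} (hv : v ∈ normals) :
    toVec v ⬝ᵥ toVec (planeBasis v).1 = 0 ∧ toVec v ⬝ᵥ toVec (planeBasis v).2 = 0 ∧
      toVec (planeBasis v).1 ⨯₃ toVec (planeBasis v).2 ≠ 0 := by
  have h : (normals.all fun v => isOrth v (planeBasis v).1 && (isOrth v (planeBasis v).2 &&
      !isZero (natCross (planeBasis v).1 (planeBasis v).2))) = true := by decide +kernel
  have h := List.all_eq_true.mp h v hv
  rw [Bool.and_eq_true, Bool.and_eq_true, isOrth_iff, isOrth_iff] at h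
  refine ⟨h.1, h.2.1, ?_⟩
  rw [toVec_cross, Ne, ← isZero_iff]
  simpa using h.2.2

theorem toVec_planePoint (v : NatVec) (s : ℕ) :
    toVec (planePoint v s) = (s : F) • toVec (planeBasis v).1 + toVec (planeBasis v).2 := by
  funext j
  fin_cases j <;> simp [planePoint, toVec]

theorem eval_form (l : List (List ℕ)) (p : NatVec) :
    eval (toVec p) (form l) = (natTernaryForm p.1 p.2.1 p.2.2 l : F) := by
  rw [form, map_ternaryForm, natCast_natTernaryForm]
  simp [toVec]

theorem eval_tableDer (g h : List (List ℕ)) (p : NatVec) :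
    (fun j => eval (toVec p) (tableDer g h (X j))) = toVec (tableVal g h p) := by
  funext j
  rw [tableDer, mkDerivation_X]
  fin_cases j
  · simp [tableVal, toVec]
  · change eval (toVec p) (X 1 * form g) = ((_ % 251 : ℕ) : F)
    rw [map_mul, eval_X, eval_form, ZMod.natCast_mod, Nat.cast_mul]
    rfl
  · change eval (toVec p) (X 2 * form h) = ((_ % 251 : ℕ) : F)
    rw [map_mul, eval_X, eval_form, ZMod.natCast_mod, Nat.cast_mul]
    rfl

theorem form_isHomogeneous {r : List ℕ} {l : List (List ℕ)}
    (h : isTriangular (r :: l) = true) : (form (r :: l)).IsHomogeneous l.length :=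
  ternaryForm_isHomogeneous h

theorem tableDer_isHomogeneous {g h : List (List ℕ)} {d : ℕ} (hg : (form g).IsHomogeneous d)
    (hh : (form h).IsHomogeneous d) (j : Fin 3) :
    (tableDer g h (X j)).IsHomogeneous (d + 1) := by
  rw [tableDer, mkDerivation_X]
  fin_cases j
  · exact isHomogeneous_zero _ _ _
  · simpa [add_comm] using (isHomogeneous_X F (1 : Fin 3)).mul hg
  · simpa [add_comm] using (isHomogeneous_X F (2 : Fin 3)).mul hh

theorem tableDer_mem {g h : List (List ℕ)} {d : ℕ} (hd : d + 2 ≤ 251)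
    (hg : (form g).IsHomogeneous d) (hh : (form h).IsHomogeneous d)
    (htan : normals.all (isTangent g h (d + 2)) = true) {Q : S}
    (hQ : IsDefiningPoly realization Q) : tableDer g h ∈ DerModule Q := by
  rw [hQ.mem_iff]
  intro f hf hmem
  obtain ⟨v, hv, hvf⟩ := mem_realization.mp hmem
  obtain ⟨c, rfl⟩ := exists_eq_smul_of_ker_le (f := lf (toVec v)) (g := f) hvf.le
  have hc : c ≠ 0 := by rintro rfl; simp at hf
  rw [linPoly_smul, Derivation.leibniz, derivation_C, smul_zero, add_zero, smul_eq_mul]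
  refine mul_dvd_mul_left _ ?_
  have hhom : (tableDer g h (linPoly (lf (toVec v)))).IsHomogeneous (d + 1) := by
    rw [der_linPoly]
    refine IsHomogeneous.sum _ _ _ fun j _ => ?_
    simpa using (isHomogeneous_C _ _).mul (tableDer_isHomogeneous hg hh j)
  obtain ⟨h1, h2, h3⟩ := planeBasis_spec hv
  refine linPoly_dvd_of_points hhom (normals_ne_zero hv) h1 h2 h3
    ((Finset.range (d + 2)).image fun s : ℕ => (s : F)) ?_ ?_
  · rw [Finset.card_image_of_injOn, Finset.card_range]
    · exact Nat.lt_succ_self _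
    · intro s hs t ht hst
      rw [Finset.mem_coe, Finset.mem_range] at hs ht
      have := (ZMod.natCast_eq_natCast_iff' s t 251).mp hst
      rwa [Nat.mod_eq_of_lt (by omega), Nat.mod_eq_of_lt (by omega)] at this
  · intro s hs
    obtain ⟨s, hmem, rfl⟩ := Finset.mem_image.mp hs
    have hs := List.all_eq_true.mp (List.all_eq_true.mp htan v hv) s
      (List.mem_range.mpr (Finset.mem_range.mp hmem))
    rw [isOrth_iff, ← eval_tableDer] at hs
    rw [← toVec_planePoint, der_linPoly, map_sum, ← hs, dotProduct]
    refine Finset.sum_congr rfl fun j _ => ?_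
    rw [map_mul, eval_C, lf_single]

theorem second_isHomogeneous : (form secondY).IsHomogeneous 10 ∧
    (form secondZ).IsHomogeneous 10 :=
  ⟨form_isHomogeneous (by decide +kernel), form_isHomogeneous (by decide +kernel)⟩

theorem third_isHomogeneous : (form thirdY).IsHomogeneous 14 ∧
    (form thirdZ).IsHomogeneous 14 :=
  ⟨form_isHomogeneous (by decide +kernel), form_isHomogeneous (by decide +kernel)⟩

theorem second_isTangent : normals.all (isTangent secondY secondZ 12) = true := by
  decide +kernel

theorem third_isTangent : normals.all (isTangent thirdY thirdZ 16) = true := by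
  decide +kernel

/-- The derivations of degrees `1`, `11` and `15` forming a basis of the module of
derivations of the realization. -/
noncomputable def basisDer : Fin 3 → Dr :=
  ![euler F 3, tableDer secondY secondZ, tableDer thirdY thirdZ]

theorem basisDer_mem {Q : S} (hQ : IsDefiningPoly realization Q) (i : Fin 3) :
    basisDer i ∈ DerModule Q := by
  fin_cases i
  · exact euler_mem hQ
  · exact tableDer_mem (by norm_num) second_isHomogeneous.1 second_isHomogeneous.2
      second_isTangent hQ
  · exact tableDer_mem (by norm_num) third_isHomogeneous.1 third_isHomogeneous.2
      third_isTangent hQ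

theorem basisDer_isHomogeneous (i j : Fin 3) :
    (basisDer i (X j)).IsHomogeneous (![1, 11, 15] i) := by
  fin_cases i
  · change (euler F 3 (X j)).IsHomogeneous 1
    rw [euler_X]
    exact isHomogeneous_X _ _
  · exact tableDer_isHomogeneous second_isHomogeneous.1 second_isHomogeneous.2 j
  · exact tableDer_isHomogeneous third_isHomogeneous.1 third_isHomogeneous.2 j

theorem det_basisDer : (Matrix.of fun i j => basisDer i (X j)).det =
    X 0 * (X 1 * form secondY * (X 2 * form thirdZ) -
      X 2 * form secondZ * (X 1 * form thirdY)) := by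
  rw [Matrix.det_fin_three]
  simp [basisDer, tableDer, mkDerivation_X, euler_X]
  ring

theorem exists_det_basisDer {Q : S} (hQ : IsDefiningPoly realization Q) :
    ∃ c : F, c ≠ 0 ∧ (Matrix.of fun i j => basisDer i (X j)).det = C c * Q := by
  have hdeg : (Matrix.of fun i j => basisDer i (X j)).det.IsHomogeneous 27 := by
    rw [det_basisDer]
    have hX (j : Fin 3) := isHomogeneous_X F j
    refine (hX 0).mul (n := 26) (IsHomogeneous.sub ?_ ?_)
    · exact ((hX 1).mul second_isHomogeneous.1).mul ((hX 2).mul third_isHomogeneous.2)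
    · exact ((hX 2).mul second_isHomogeneous.2).mul ((hX 1).mul third_isHomogeneous.1)
  obtain ⟨c, hc⟩ := exists_C_mul_of_dvd hdeg (card_realization ▸ hQ.isHomogeneous)
    (hQ.dvd_det basisDer (basisDer_mem hQ))
  refine ⟨c, ?_, hc⟩
  rintro rfl
  rw [C_0, zero_mul, det_basisDer] at hc
  have h1 := congrArg (eval (toVec (1, 1, 1))) hc
  have h2 : ((natTernaryForm 1 1 1 secondY * natTernaryForm 1 1 1 thirdZ +
      250 * (natTernaryForm 1 1 1 secondZ * natTernaryForm 1 1 1 thirdY) : ℕ) : F) = 0 := by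
    have h : ((250 : ℕ) : F) = -1 := by decide
    simp only [map_mul, map_sub, eval_X, eval_form, map_zero] at h1
    rw [Nat.cast_add, Nat.cast_mul, Nat.cast_mul 250, h, Nat.cast_mul, ← h1]
    simp [toVec]
    ring
  rw [natCast_eq_zero_iff] at h2
  revert h2
  decide +kernel

theorem exists_basis_realization {Q : S} (hQ : IsDefiningPoly realization Q) :
    ∃ b : Basis (Fin 3) S (DerModule Q), ∀ i, (b i : Dr) = basisDer i := by
  obtain ⟨c, hc, hdet⟩ := exists_det_basisDer hQ
  exact exists_basis_of_det hQ basisDer (basisDer_mem hQ) hc hdet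

theorem isFree_realization : IsFree realization := by
  obtain ⟨Q, hQ⟩ := exists_isDefiningPoly realization
  obtain ⟨b, -⟩ := exists_basis_realization hQ
  exact ⟨Q, hQ, Module.Free.of_basis b⟩

/-- Every plane of the realization has a point where the second basis derivation is not
radial. -/
theorem exists_not_radial {H : Submodule F (Fin 3 → F)} (hH : H ∈ realization.hyperplanes) :
    ∃ p ∈ H, ∀ a c : F, (∀ j, a * p j + c * eval p (basisDer 1 (X j)) = 0) → c = 0 := by
  obtain ⟨v, hv, rfl⟩ := mem_realization.mp hH
  have h : (normals.all fun v => (List.range 12).any fun s =>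
      !isZero (natCross (planePoint v s) (tableVal secondY secondZ (planePoint v s)))) = true := by
    decide +kernel
  obtain ⟨s, -, hs⟩ := List.any_eq_true.mp (List.all_eq_true.mp h v hv)
  have hs : toVec (planePoint v s) ⨯₃
      toVec (tableVal secondY secondZ (planePoint v s)) ≠ 0 := by
    rw [toVec_cross, Ne, ← isZero_iff]
    simpa using hs
  obtain ⟨h1, h2, -⟩ := planeBasis_spec hv
  refine ⟨toVec (planePoint v s), ?_, fun a c hac => ?_⟩
  · rw [mem_perp, toVec_planePoint, dotProduct_add, dotProduct_smul, h1, h2]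
    simp
  · have hvec : a • toVec (planePoint v s) +
        c • toVec (tableVal secondY secondZ (planePoint v s)) = 0 := by
      rw [← eval_tableDer]
      funext j
      exact hac j
    have := congrArg (fun x => toVec (planePoint v s) ⨯₃ x) hvec
    simp only [map_add, map_smul, cross_self, smul_zero, zero_add, map_zero] at this
    exact (smul_eq_zero.mp this).resolve_right hs

theorem not_recursivelyFree_realization : ¬ RecursivelyFree F realization := by
  obtain ⟨Q, hQ⟩ := exists_isDefiningPoly realization
  obtain ⟨b, hb⟩ := exists_basis_realization hQ
  refine not_recursivelyFree hQ b ?_ ?_ ?_ ?_ ?_ ?_ ?_ ?_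
  · intro i j
    rw [hb]
    exact basisDer_isHomogeneous i j
  · rw [hb]
    rfl
  · rw [hb]
    simp [basisDer, tableDer, mkDerivation_X]
  · refine mem_realization.mpr ⟨(1, 0, 0), by decide +kernel, ?_⟩
    ext x
    simp [mem_perp, toVec, dotProduct, Fin.sum_univ_three]
  · intro m hm hm' h0
    rw [card_realization] at hm'
    rw [natCast_eq_zero_iff, Nat.mod_eq_of_lt (by omega)] at h0
    omega
  · exact fun H hH B hB => card_restriction_realization hH hB
  · intro H hH
    rw [hb]
    exact exists_not_radial hH
  · exact fun A' H hH hA B hB => card_restriction_extension hH hA hB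

end Basis

section LatticeIso

theorem exists_orderIso_of_surjective {α β γ : Type*} [PartialOrder β] [PartialOrder γ]
    {f : α → β} {g : α → γ} (hf : Function.Surjective f) (hg : Function.Surjective g)
    (h : ∀ a b, f a ≤ f b ↔ g a ≤ g b) : Nonempty (β ≃o γ) := by
  have hfg (x : β) : ∃ a, f a = x := hf x
  choose s hs using hfg
  refine ⟨RelIso.ofSurjective (OrderEmbedding.ofMapLEIff (fun x => g (s x)) fun x y => ?_) ?_⟩
  · rw [← h, hs, hs]
  · intro y
    obtain ⟨a, rfl⟩ := hg y
    refine ⟨f a, ?_⟩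
    exact le_antisymm ((h _ _).mp (hs (f a)).le) ((h _ _).mp (hs (f a)).ge)

variable {K K' : Type*} [Field K] [Field K']

theorem surjective_finset_inf {n : ℕ} {ι : Type*} (P : ι → Submodule K (Fin n → K)) :
    Function.Surjective fun s : Finset ι =>
      (⟨s.inf P, s.image P, by simp, by simp [Finset.inf_image]⟩ :
        setLattice (Set.range P)) := by
  rintro ⟨X, s, hs, rfl⟩
  obtain ⟨t, rfl⟩ : ∃ t : Finset ι, t.image P = s := by
    rw [← Set.image_univ, Finset.subset_set_image_iff] at hs
    obtain ⟨t, -, ht⟩ := hs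
    exact ⟨t, ht⟩
  exact ⟨t, Subtype.ext (by simp [Finset.inf_image])⟩

/-- Families with the same closure operator have isomorphic intersection lattices. -/
theorem setLattice_orderIso {n : ℕ} {ι : Type*} {P : ι → Submodule K (Fin n → K)}
    {P' : ι → Submodule K' (Fin n → K')}
    (h : ∀ (s : Finset ι) (i : ι), s.inf P ≤ P i ↔ s.inf P' ≤ P' i) :
    Nonempty (setLattice (Set.range P) ≃o setLattice (Set.range P')) := by
  refine exists_orderIso_of_surjective (surjective_finset_inf P) (surjective_finset_inf P')
    fun s t => ?_
  change s.inf P ≤ t.inf P ↔ s.inf P' ≤ t.inf P'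
  rw [Finset.le_inf_iff, Finset.le_inf_iff]
  exact forall₂_congr fun i _ => h s i

theorem inf_perp_le_perp_iff {ι : Type*} {v : ι → Fin 3 → K} (h0 : ∀ i, v i ≠ 0)
    (h2 : ∀ i j, i ≠ j → v i ⨯₃ v j ≠ 0) (s : Finset ι) (i : ι) :
    (s.inf fun j => perp (v j)) ≤ perp (v i) ↔ i ∈ s ∨
      (∃ j ∈ s, ∃ k ∈ s, j ≠ k ∧ v i ⬝ᵥ (v j ⨯₃ v k) = 0) ∨
      ∃ j ∈ s, ∃ k ∈ s, ∃ l ∈ s, v l ⬝ᵥ (v j ⨯₃ v k) ≠ 0 := by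
  have hmem (x : Fin 3 → K) : x ∈ (s.inf fun j => perp (v j)) ↔ ∀ j ∈ s, v j ⬝ᵥ x = 0 := by
    simp [Submodule.mem_finsetInf, mem_perp]
  have key {j k : ι} {x : Fin 3 → K} (hjk : v j ⨯₃ v k ≠ 0) (hj : v j ⬝ᵥ x = 0)
      (hk : v k ⬝ᵥ x = 0) : ∃ c : K, x = c • (v j ⨯₃ v k) :=
    exists_smul_cross_of_dot_eq_zero hjk (by rwa [dotProduct_comm]) (by rwa [dotProduct_comm])
  constructor
  · intro h
    by_contra! hc
    obtain ⟨hi, h3, h4⟩ := hc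
    have hsub : ∀ j ∈ s, ∀ k ∈ s, j = k := by
      intro j hj k hk
      by_contra hjk
      exact h3 j hj k hk hjk (mem_perp.mp (h ((hmem _).mpr fun l hl => h4 j hj k hk l hl)))
    rcases s.eq_empty_or_nonempty with rfl | ⟨j, hj⟩
    · refine h0 i (funext fun k => ?_)
      have : Pi.single k 1 ∈ perp (v i) := h (by simp)
      simpa [mem_perp] using this
    · have hij : i ≠ j := by rintro rfl; exact hi hj
      have hle : LinearMap.ker (lf (v j)) ≤ LinearMap.ker (lf (v i)) := fun x hx =>
        h ((hmem x).mpr fun k hk => by rw [← hsub j hj k hk]; exact mem_perp.mp hx)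
      obtain ⟨c, hc⟩ := exists_eq_smul_of_ker_le hle
      refine h2 i j hij ?_
      have : v i = c • v j := by
        funext k
        have := congrArg (fun f : (Fin 3 → K) →ₗ[K] K => f (Pi.single k 1)) hc
        simpa [lf_single] using this
      rw [this]
      simp
  · rintro (hi | ⟨j, hj, k, hk, hjk, h⟩ | ⟨j, hj, k, hk, l, hl, h⟩) x hx
    · exact mem_perp.mpr ((hmem x).mp hx i hi)
    · obtain ⟨c, rfl⟩ := key (h2 j k hjk) ((hmem x).mp hx j hj) ((hmem x).mp hx k hk)
      rw [mem_perp, dotProduct_smul, h, smul_zero]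
    · have hjk : v j ⨯₃ v k ≠ 0 := fun h' => h (by rw [h', dotProduct_zero])
      obtain ⟨c, rfl⟩ := key hjk ((hmem x).mp hx j hj) ((hmem x).mp hx k hk)
      have h5 := (hmem _).mp hx l hl
      rw [dotProduct_smul, smul_eq_mul] at h5
      rw [(mul_eq_zero.mp h5).resolve_right h, zero_smul]
      exact Submodule.zero_mem _

/-- Planes whose normal vectors have the same linearly dependent triples have isomorphic
intersection lattices. -/
theorem setLattice_orderIso_of_triples {ι : Type*} {v : ι → Fin 3 → K} {w : ι → Fin 3 → K'}
    (hv : ∀ i, v i ≠ 0) (hw : ∀ i, w i ≠ 0) (hv2 : ∀ i j, i ≠ j → v i ⨯₃ v j ≠ 0)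
    (hw2 : ∀ i j, i ≠ j → w i ⨯₃ w j ≠ 0)
    (h : ∀ i j k, v i ⬝ᵥ (v j ⨯₃ v k) = 0 ↔ w i ⬝ᵥ (w j ⨯₃ w k) = 0) :
    Nonempty (setLattice (Set.range fun i => perp (v i)) ≃o
      setLattice (Set.range fun i => perp (w i))) := by
  refine setLattice_orderIso fun s i => ?_
  rw [inf_perp_le_perp_iff hv hv2, inf_perp_le_perp_iff hw hw2]
  simp only [ne_eq, h]

end LatticeIso

section Cyclotomic

/-- Coordinates of an element of `ℤ[ζ]`, `ζ⁵ = 1`, with respect to `1, ζ, ζ², ζ³`. -/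
abbrev Cyc := ℤ × ℤ × ℤ × ℤ

abbrev CycVec := Cyc × Cyc × Cyc

namespace Cyc

def add (a b : Cyc) : Cyc := (a.1 + b.1, a.2.1 + b.2.1, a.2.2.1 + b.2.2.1, a.2.2.2 + b.2.2.2)

def neg (a : Cyc) : Cyc := (-a.1, -a.2.1, -a.2.2.1, -a.2.2.2)

def mul (a b : Cyc) : Cyc :=
  let c := a.2.1 * b.2.2.2 + a.2.2.1 * b.2.2.1 + a.2.2.2 * b.2.1
  (a.1 * b.1 + a.2.2.1 * b.2.2.2 + a.2.2.2 * b.2.2.1 - c,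
    a.1 * b.2.1 + a.2.1 * b.1 + a.2.2.2 * b.2.2.2 - c,
    a.1 * b.2.2.1 + a.2.1 * b.2.1 + a.2.2.1 * b.1 - c,
    a.1 * b.2.2.2 + a.2.1 * b.2.2.1 + a.2.2.1 * b.2.1 + a.2.2.2 * b.1 - c)

def isZero (a : Cyc) : Bool := a.1 == 0 && (a.2.1 == 0 && (a.2.2.1 == 0 && a.2.2.2 == 0))

def eval {R : Type*} [CommRing R] (z : R) (a : Cyc) : R :=
  a.1 + a.2.1 * z + a.2.2.1 * z ^ 2 + a.2.2.2 * z ^ 3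

section Eval

variable {R : Type*} [CommRing R] (z : R)

theorem eval_add (a b : Cyc) : (add a b).eval z = a.eval z + b.eval z := by
  simp only [eval, add, Int.cast_add]
  ring

theorem eval_neg (a : Cyc) : (neg a).eval z = -a.eval z := by
  simp only [eval, neg, Int.cast_neg]
  ring

variable {z}

theorem eval_mul (hz : 1 + z + z ^ 2 + z ^ 3 + z ^ 4 = 0) (a b : Cyc) :
    (mul a b).eval z = a.eval z * b.eval z := by
  simp only [eval, mul, Int.cast_add, Int.cast_sub, Int.cast_mul]
  linear_combination (-(a.2.1 * b.2.2.2 + a.2.2.1 * b.2.2.1 + a.2.2.2 * b.2.1 : R) -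
    (a.2.2.1 * b.2.2.2 + a.2.2.2 * b.2.2.1) * (z - 1) - a.2.2.2 * b.2.2.2 * z * (z - 1)) * hz

theorem eval_eq_zero_of_isZero {a : Cyc} (h : a.isZero = true) : a.eval z = 0 := by
  simp only [isZero, Bool.and_eq_true, beq_iff_eq] at h
  simp [eval, h]

end Eval

theorem eq_zero_of_eval_eq_zero {ζ : ℂ} (hζ : IsPrimitiveRoot ζ 5) {a : Cyc}
    (h : a.eval ζ = 0) : a = (0, 0, 0, 0) := by
  set p : Polynomial ℤ := Polynomial.C a.1 + Polynomial.C a.2.1 * Polynomial.X +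
    Polynomial.C a.2.2.1 * Polynomial.X ^ 2 + Polynomial.C a.2.2.2 * Polynomial.X ^ 3 with hp
  have hroot : Polynomial.aeval ζ p = 0 := by
    rw [← h, hp, eval]
    simp
  have hdvd := minpoly.isIntegrallyClosed_dvd (hζ.isIntegral (by norm_num)) hroot
  rw [← Polynomial.cyclotomic_eq_minpoly hζ (by norm_num)] at hdvd
  have hp0 : p = 0 := by
    refine Polynomial.eq_zero_of_dvd_of_natDegree_lt hdvd ?_
    rw [Polynomial.natDegree_cyclotomic, Nat.totient_prime (by norm_num)]
    refine lt_of_le_of_lt (b := 3) ?_ (by norm_num)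
    rw [hp]
    compute_degree
  have hc (k : ℕ) : p.coeff k = 0 := by rw [hp0, Polynomial.coeff_zero]
  have h0 := hc 0
  have h1 := hc 1
  have h2 := hc 2
  have h3 := hc 3
  simp [hp, Polynomial.coeff_X, Polynomial.coeff_C, -eq_intCast] at h0 h1 h2 h3
  exact Prod.ext h0 (Prod.ext h1 (Prod.ext h2 h3))

end Cyc

end Cyclotomic

section Roots

namespace CycVec

def dot (a b : CycVec) : Cyc :=
  (a.1.mul b.1).add ((a.2.1.mul b.2.1).add (a.2.2.mul b.2.2))

def cross (a b : CycVec) : CycVec :=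
  ((a.2.1.mul b.2.2).add (a.2.2.mul b.2.1).neg, (a.2.2.mul b.1).add (a.1.mul b.2.2).neg,
    (a.1.mul b.2.1).add (a.2.1.mul b.1).neg)

def isZero (a : CycVec) : Bool := a.1.isZero && (a.2.1.isZero && a.2.2.isZero)

def eval {R : Type*} [CommRing R] (z : R) (a : CycVec) : Fin 3 → R :=
  ![a.1.eval z, a.2.1.eval z, a.2.2.eval z]

/-- The action from the right of the three generators of the reflection group. -/
def act (a : CycVec) : Fin 3 → CycVec
  | 0 => (a.1, a.2.1, a.2.1.add a.2.2.neg)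
  | 1 => (a.1.neg.add (a.2.1.mul (0, 0, -1, -1)), a.2.1, a.2.2)
  | 2 => (a.1, (a.1.mul (0, 0, -1, -1)).add (a.2.1.neg.add a.2.2), a.2.2)

def reduce (a : Cyc) : ℕ := ((a.1 + 20 * a.2.1 + 149 * a.2.2.1 + 219 * a.2.2.2) % 251).toNat

/-- Reduction along `ζ ↦ 20`. -/
def toNatVec (a : CycVec) : NatVec := (reduce a.1, reduce a.2.1, reduce a.2.2)

section Eval

variable {R : Type*} [CommRing R] {z : R}

theorem eval_dot (hz : 1 + z + z ^ 2 + z ^ 3 + z ^ 4 = 0) (a b : CycVec) :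
    (dot a b).eval z = a.eval z ⬝ᵥ b.eval z := by
  simp [dot, eval, Cyc.eval_add, Cyc.eval_mul hz, dotProduct, Fin.sum_univ_three, add_assoc]

theorem eval_cross (hz : 1 + z + z ^ 2 + z ^ 3 + z ^ 4 = 0) (a b : CycVec) :
    (cross a b).eval z = a.eval z ⨯₃ b.eval z := by
  simp [cross, eval, Cyc.eval_add, Cyc.eval_neg, Cyc.eval_mul hz, cross_apply, sub_eq_add_neg]

theorem eval_eq_zero_of_isZero {a : CycVec} (h : a.isZero = true) : a.eval z = 0 := by
  rw [isZero, Bool.and_eq_true, Bool.and_eq_true] at h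
  simp [eval, Cyc.eval_eq_zero_of_isZero h.1, Cyc.eval_eq_zero_of_isZero h.2.1,
    Cyc.eval_eq_zero_of_isZero h.2.2]

end Eval

theorem eval_twenty (a : CycVec) : a.eval (20 : ZMod 251) = toVec a.toNatVec := by
  have h (c : Cyc) : c.eval (20 : ZMod 251) = (reduce c : ZMod 251) := by
    have h2 : (20 : ZMod 251) ^ 2 = (149 : ℤ) := by decide
    have h3 : (20 : ZMod 251) ^ 3 = (219 : ℤ) := by decide
    have hnonneg : 0 ≤ (c.1 + 20 * c.2.1 + 149 * c.2.2.1 + 219 * c.2.2.2) % 251 :=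
      Int.emod_nonneg _ (by norm_num)
    have hcast : (reduce c : ZMod 251) = (((reduce c : ℕ) : ℤ) : ZMod 251) := by simp
    rw [hcast, reduce, Int.toNat_of_nonneg hnonneg]
    have := ZMod.intCast_mod (c.1 + 20 * c.2.1 + 149 * c.2.2.1 + 219 * c.2.2.2) 251
    rw [Nat.cast_ofNat] at this
    rw [this, Cyc.eval, h2, h3]
    push_cast
    ring
  simp [eval, toNatVec, toVec, h]

theorem eval_twenty_eq_zero {ζ : ℂ} (hζ : IsPrimitiveRoot ζ 5) {a : Cyc} (h : a.eval ζ = 0) :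
    a.eval (20 : ZMod 251) = 0 := by
  rw [Cyc.eq_zero_of_eval_eq_zero hζ h]
  simp [Cyc.eval]

end CycVec

def roots : List CycVec := [
  ((1, 0, 0, 0), (0, 0, 0, 0), (0, 0, 0, 0)), ((0, 0, 0, 0), (1, 0, 0, 0), (0, 0, 0, 0)),
  ((0, 0, 0, 0), (0, 0, 0, 0), (1, 0, 0, 0)), ((1, 0, 0, 0), (0, 0, -1, 0), (0, 0, 0, 0)),
  ((1, 0, 0, 0), (0, 0, -1, -1), (0, 0, 0, 0)), ((0, 0, 0, 0), (1, 0, 0, 0), (1, 0, 0, 0)),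
  ((1, 1, 0, 0), (0, 0, 0, -1), (0, 0, 0, 0)), ((1, 0, 0, 0), (0, 0, -1, 0), (0, 0, -1, 0)),
  ((1, 0, 0, 0), (0, 0, 0, -1), (0, 0, 0, 0)), ((1, 0, 0, 0), (0, 0, -1, -1), (0, 0, -1, -1)),
  ((1, 1, 0, 0), (1, 1, 0, 0), (0, 0, 0, 0)), ((1, 1, 0, 0), (0, 0, 0, -1), (0, 0, 0, -1)),
  ((1, 0, 0, 0), (0, 0, 0, -1), (0, 0, 0, -1)), ((1, 0, 0, 0), (0, 0, -1, -1), (0, 0, -1, 0)),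
  ((1, 1, 0, 0), (1, 1, 0, 0), (1, 1, 0, 0)), ((1, 1, 0, 0), (1, 1, 0, -1), (0, 0, 0, -1)),
  ((1, 0, 0, 0), (0, 0, -1, -1), (0, 0, 0, -1)), ((1, 1, 0, 0), (1, 1, 0, 0), (1, 0, 0, 0)),
  ((1, 1, 0, 0), (1, 1, 0, -1), (1, 1, 0, 0)), ((1, 1, 0, -1), (1, 1, 0, -1), (0, 0, 0, -1)),
  ((1, 1, 0, 0), (1, 1, 0, 0), (0, 1, 0, 0)), ((1, 1, 0, 0), (1, 0, 0, -1), (1, 0, 0, 0)),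
  ((1, 1, 0, -1), (1, 1, 0, -1), (1, 1, 0, 0)), ((1, 1, 0, 0), (0, 1, 0, -1), (0, 1, 0, 0)),
  ((1, 1, 0, 0), (1, 0, 0, -1), (0, 0, 0, -1)), ((1, 1, 0, 0), (0, 1, 0, -1), (0, 0, 0, -1)),
  ((1, 1, 0, -1), (2, 2, 0, 0), (1, 1, 0, 0))]

theorem map_toNatVec_roots : roots.map CycVec.toNatVec = normals := by decide +kernel

def allTriples {α : Type*} (P : α → α → α → Bool) : List α → Bool
  | [] => true
  | a :: l => allPairs (P a) l && allTriples P l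

theorem of_allTriples {α : Type*} {P : α → α → α → Bool} {R : α → α → α → Prop}
    (hP : ∀ a b c, P a b c = true → R a b c) (hself : ∀ a b, R a b b)
    (hswap : ∀ a b c, R a b c → R b a c) (hswap' : ∀ a b c, R a b c → R a c b)
    {l : List α} (h : allTriples P l = true) : ∀ a ∈ l, ∀ b ∈ l, ∀ c ∈ l, R a b c := by
  induction l with
  | nil => simp
  | cons d l ih =>
    rw [allTriples, Bool.and_eq_true] at h
    have hd : ∀ b ∈ l, ∀ c ∈ l, R d b c := by
      intro b hb c hc
      rcases eq_or_ne b c with rfl | hbc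
      · exact hself d b
      · have : Std.Symm fun b c => R d b c := ⟨fun b c h => hswap' d b c h⟩
        exact ((pairwise_of_allPairs h.1).imp fun {b c} h => hP d b c h).forall hb hc hbc
    intro a ha b hb c hc
    rcases List.mem_cons.mp ha with rfl | ha' <;> rcases List.mem_cons.mp hb with rfl | hb' <;>
      rcases List.mem_cons.mp hc with rfl | hc'
    · exact hself _ _
    · exact hswap' _ _ _ (hswap _ _ _ (hself _ _))
    · exact hswap _ _ _ (hself _ _)
    · exact hd b hb' c hc'
    · exact hself _ _
    · exact hswap _ _ _ (hd a ha' c hc')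
    · exact hswap' _ _ _ (hswap _ _ _ (hd a ha' b hb'))
    · exact ih h.2 a ha' b hb' c hc'

theorem roots_check : allTriples (fun a b c =>
    !isOrth a.toNatVec (natCross b.toNatVec c.toNatVec) ||
      (a.dot (b.cross c)).isZero) roots = true := by
  decide +kernel

/-- The planes with normal vectors `roots`, evaluated at `z`. -/
def rootPlanes {K : Type*} [Field K] (z : K) : Set (Submodule K (Fin 3 → K)) :=
  Set.range fun r : {r // r ∈ roots} => perp (r.1.eval z)

theorem roots_act (k : Fin 3) {r : CycVec} (hr : r ∈ roots) :
    ∃ s ∈ roots, ((r.act k).cross s).isZero = true := by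
  have h : (roots.all fun r => [0, 1, 2].all fun k => roots.any fun s =>
      ((r.act k).cross s).isZero) = true := by decide +kernel
  have := List.all_eq_true.mp (List.all_eq_true.mp h r hr) k (by fin_cases k <;> simp)
  simpa using this

/-- Every further entry of the list is parallel to the image of a previous one under a
generator. -/
def isReachable (seen : List CycVec) : List CycVec → Bool
  | [] => true
  | r :: l => (seen.any fun s => [0, 1, 2].any fun k => ((s.act k).cross r).isZero) &&
      isReachable (r :: seen) l

def seeds : List CycVec :=
  [((1, 0, 0, 0), (0, 0, 0, 0), (0, 0, 0, 0)), ((0, 0, 0, 0), (1, 0, 0, 0), (0, 0, 0, 0)),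
    ((0, 0, 0, 0), (0, 0, 0, 0), (1, 0, 0, 0)), ((1, 0, 0, 0), (0, 0, -1, 0), (0, 0, 0, 0))]

theorem seeds_subset : ∀ r ∈ seeds, r ∈ roots := by decide +kernel

theorem roots_reachable : isReachable seeds (roots.drop 4) = true := by decide +kernel

theorem roots_eq : roots = seeds ++ roots.drop 4 := rfl

attribute [irreducible] roots

theorem toNatVec_mem {r : CycVec} (hr : r ∈ roots) : r.toNatVec ∈ normals := by
  rw [← map_toNatVec_roots]
  exact List.mem_map_of_mem hr

theorem toNatVec_injOn {r s : CycVec} (hr : r ∈ roots) (hs : s ∈ roots)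
    (h : r.toNatVec = s.toNatVec) : r = s :=
  List.inj_on_of_nodup_map (map_toNatVec_roots ▸ normals_nodup) hr hs h

theorem realization_eq_rootPlanes :
    (realization.hyperplanes : Set (Submodule (ZMod 251) (Fin 3 → ZMod 251))) =
      rootPlanes 20 := by
  ext H
  rw [Finset.mem_coe, mem_realization, rootPlanes, Set.mem_range, ← map_toNatVec_roots]
  constructor
  · rintro ⟨v, hv, rfl⟩
    obtain ⟨r, hr, rfl⟩ := List.mem_map.mp hv
    exact ⟨⟨r, hr⟩, by rw [CycVec.eval_twenty]⟩
  · rintro ⟨⟨r, hr⟩, rfl⟩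
    exact ⟨_, List.mem_map_of_mem hr, by rw [CycVec.eval_twenty]⟩

theorem one_add_geom_eq_zero {ζ : ℂ} (hζ : IsPrimitiveRoot ζ 5) :
    1 + ζ + ζ ^ 2 + ζ ^ 3 + ζ ^ 4 = 0 := by
  have := hζ.geom_sum_eq_zero (by norm_num)
  simpa [Finset.sum_range_succ] using this

theorem twenty_geom : 1 + (20 : ZMod 251) + 20 ^ 2 + 20 ^ 3 + 20 ^ 4 = 0 := by decide

theorem CycVec.eval_ne_zero {ζ : ℂ} (hζ : IsPrimitiveRoot ζ 5) {a : CycVec}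
    (h : a.eval (20 : ZMod 251) ≠ 0) : a.eval ζ ≠ 0 := by
  intro h0
  apply h
  have hc (j : Fin 3) := congrFun h0 j
  funext j
  fin_cases j
  · exact eval_twenty_eq_zero hζ (hc 0)
  · exact eval_twenty_eq_zero hζ (hc 1)
  · exact eval_twenty_eq_zero hζ (hc 2)

theorem lattice_realization {ζ : ℂ} (hζ : IsPrimitiveRoot ζ 5) :
    Nonempty (realization.lattice ≃o setLattice (rootPlanes ζ)) := by
  have hz := one_add_geom_eq_zero hζ
  have h0 (r : {r // r ∈ roots}) : r.1.eval (20 : ZMod 251) ≠ 0 := by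
    rw [CycVec.eval_twenty]
    exact normals_ne_zero (toNatVec_mem r.2)
  have h2 (r s : {r // r ∈ roots}) (hrs : r ≠ s) :
      r.1.eval (20 : ZMod 251) ⨯₃ s.1.eval 20 ≠ 0 := by
    rw [CycVec.eval_twenty, CycVec.eval_twenty]
    refine normals_cross_ne_zero (toNatVec_mem r.2) (toNatVec_mem s.2) fun h => ?_
    exact hrs (Subtype.ext (toNatVec_injOn r.2 s.2 h))
  rw [Arrangement.lattice, realization_eq_rootPlanes]
  refine setLattice_orderIso_of_triples h0 (fun r => CycVec.eval_ne_zero hζ (h0 r)) h2 ?_ ?_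
  · intro r s hrs
    rw [← CycVec.eval_cross hz]
    refine CycVec.eval_ne_zero hζ ?_
    rw [CycVec.eval_cross twenty_geom]
    exact h2 r s hrs
  · have h3 {K : Type} [Field K] (a b c : Fin 3 → K) :
        b ⬝ᵥ (a ⨯₃ c) = -(a ⬝ᵥ (b ⨯₃ c)) ∧ a ⬝ᵥ (c ⨯₃ b) = -(a ⬝ᵥ (b ⨯₃ c)) := by
      simp only [cross_apply, dotProduct, Fin.sum_univ_three, Matrix.cons_val_zero,
        Matrix.cons_val_one, Matrix.cons_val]
      constructor <;> ring
    have key := of_allTriples (R := fun a b c : CycVec =>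
      a.eval (20 : ZMod 251) ⬝ᵥ (b.eval 20 ⨯₃ c.eval 20) = 0 →
        a.eval ζ ⬝ᵥ (b.eval ζ ⨯₃ c.eval ζ) = 0) ?_ ?_ ?_ ?_ roots_check
    · intro r s t
      refine ⟨key _ r.2 _ s.2 _ t.2, fun h => ?_⟩
      rw [← CycVec.eval_cross hz, ← CycVec.eval_dot hz] at h
      rw [← CycVec.eval_cross twenty_geom, ← CycVec.eval_dot twenty_geom]
      exact CycVec.eval_twenty_eq_zero hζ h
    · intro a b c h hF
      rw [CycVec.eval_twenty, CycVec.eval_twenty, CycVec.eval_twenty, toVec_cross,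
        ← isOrth_iff] at hF
      rw [hF, Bool.not_true, Bool.false_or] at h
      rw [← CycVec.eval_cross hz, ← CycVec.eval_dot hz]
      exact Cyc.eval_eq_zero_of_isZero h
    · intro a b _
      rw [cross_self, dotProduct_zero]
    · intro a b c h hF
      rw [(h3 _ _ _).1, neg_eq_zero] at hF ⊢
      exact h hF
    · intro a b c h hF
      rw [(h3 _ _ _).2, neg_eq_zero] at hF ⊢
      exact h hF

end Roots

section Orbit

theorem perp_vecMul {K : Type*} [Field K] {n : ℕ} (w : Fin n → K) (g : Matrix (Fin n) (Fin n) K) :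
    perp (w ᵥ* g) = (perp w).comap g.mulVecLin := by
  ext x
  rw [Submodule.mem_comap, mem_perp, mem_perp, Matrix.mulVecLin_apply, Matrix.dotProduct_mulVec]

/-- The generators of the reflection group; `-z ^ 2 - z ^ 3` is the golden ratio. -/
def reflection {R : Type*} [CommRing R] (z : R) : Fin 3 → Matrix (Fin 3) (Fin 3) R
  | 0 => !![1, 0, 0; 0, 1, 1; 0, 0, -1]
  | 1 => !![-1, 0, 0; -z ^ 2 - z ^ 3, 1, 0; 0, 0, 1]
  | 2 => !![1, -z ^ 2 - z ^ 3, 0; 0, -1, 0; 0, 1, 1]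

theorem reflection_mul_self {R : Type*} [CommRing R] (z : R) (k : Fin 3) :
    reflection z k * reflection z k = 1 := by
  ext i j
  fin_cases k <;> fin_cases i <;> fin_cases j <;>
    simp [reflection, Matrix.mul_apply, Fin.sum_univ_three] <;> ring

theorem CycVec.eval_act {R : Type*} [CommRing R] {z : R} (hz : 1 + z + z ^ 2 + z ^ 3 + z ^ 4 = 0)
    (a : CycVec) (k : Fin 3) : (a.act k).eval z = a.eval z ᵥ* reflection z k := by
  have h : Cyc.eval z (0, 0, -1, -1) = -z ^ 2 - z ^ 3 := by
    simp [Cyc.eval]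
    ring
  funext j
  fin_cases k <;> fin_cases j <;>
    simp [CycVec.eval, CycVec.act, reflection, Matrix.vecMul, dotProduct, Fin.sum_univ_three,
      Cyc.eval_add, Cyc.eval_neg, Cyc.eval_mul hz, h]
  all_goals ring

theorem CycVec.eval_ne_zero_of_mem {ζ : ℂ} (hζ : IsPrimitiveRoot ζ 5) {r : CycVec}
    (hr : r ∈ roots) : r.eval ζ ≠ 0 := by
  refine CycVec.eval_ne_zero hζ ?_
  rw [CycVec.eval_twenty]
  exact normals_ne_zero (toNatVec_mem hr)

theorem perp_reflection {ζ : ℂ} (hζ : IsPrimitiveRoot ζ 5) {r s : CycVec} (hr : r ∈ roots)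
    (hs : s ∈ roots) {k : Fin 3} (h : ((r.act k).cross s).isZero = true) :
    perp (r.eval ζ ᵥ* reflection ζ k) = perp (s.eval ζ) := by
  have hz := one_add_geom_eq_zero hζ
  rw [perp_eq_perp_iff _ (CycVec.eval_ne_zero_of_mem hζ hs), ← CycVec.eval_act hz,
    ← CycVec.eval_cross hz]
  · exact CycVec.eval_eq_zero_of_isZero h
  · intro h0
    apply CycVec.eval_ne_zero_of_mem hζ hr
    rw [← Matrix.vecMul_one (r.eval ζ), ← reflection_mul_self ζ k, ← Matrix.vecMul_vecMul, h0,
      Matrix.zero_vecMul]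

theorem of_isReachable {P : CycVec → Prop}
    (hP : ∀ r ∈ roots, ∀ s ∈ roots, ∀ k, ((r.act k).cross s).isZero = true → P r → P s)
    {l seen : List CycVec} (hl : ∀ r ∈ l, r ∈ roots) (hseen : ∀ r ∈ seen, r ∈ roots ∧ P r)
    (h : isReachable seen l = true) : ∀ r ∈ l, P r := by
  induction l generalizing seen with
  | nil => simp
  | cons a l ih =>
    rw [isReachable, Bool.and_eq_true, List.any_eq_true] at h
    obtain ⟨⟨s, hs, hk⟩, h'⟩ := h
    obtain ⟨k, -, hk⟩ := List.any_eq_true.mp hk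
    have ha := hl a List.mem_cons_self
    have hPa : P a := hP s (hseen s hs).1 a ha k hk (hseen s hs).2
    have hrest := ih (fun r hr => hl r (List.mem_cons_of_mem _ hr))
      (List.forall_mem_cons.mpr ⟨⟨ha, hPa⟩, hseen⟩) h'
    exact List.forall_mem_cons.mpr ⟨hPa, hrest⟩

theorem image_perp_orbit {ζ : ℂ} (hζ : IsPrimitiveRoot ζ 5) {g : Fin 3 → GL (Fin 3) ℂ}
    (hg : ∀ k, (g k : Matrix (Fin 3) (Fin 3) ℂ) = reflection ζ k) {R : Set (Fin 3 → ℂ)}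
    (hR : ∀ w, w ∈ R ↔ ∃ h ∈ Subgroup.closure (Set.range g), ∃ r ∈ seeds,
      w = r.eval ζ ᵥ* (h : Matrix (Fin 3) (Fin 3) ℂ)) :
    perp '' R = rootPlanes ζ := by
  apply Set.Subset.antisymm
  · have hgen (k : Fin 3) {r : CycVec} (hr : r ∈ roots) :
        ∃ s ∈ roots, perp (r.eval ζ ᵥ* (g k : Matrix (Fin 3) (Fin 3) ℂ)) = perp (s.eval ζ) := by
      obtain ⟨s, hs, h⟩ := roots_act k hr
      exact ⟨s, hs, by rw [hg, perp_reflection hζ hr hs h]⟩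
    have hinv (k : Fin 3) : (g k)⁻¹ = g k := by
      refine inv_eq_of_mul_eq_one_left (Units.ext ?_)
      rw [Units.val_mul, hg, reflection_mul_self, Units.val_one]
    have key (h : GL (Fin 3) ℂ) (hh : h ∈ Subgroup.closure (Set.range g)) : ∀ r ∈ roots,
        ∃ s ∈ roots, perp (r.eval ζ ᵥ* (h : Matrix (Fin 3) (Fin 3) ℂ)) = perp (s.eval ζ) := by
      induction hh using Subgroup.closure_induction'' with
      | mem x hx =>
        obtain ⟨k, rfl⟩ := hx
        exact fun r hr => hgen k hr
      | inv_mem x hx =>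
        obtain ⟨k, rfl⟩ := hx
        rw [hinv]
        exact fun r hr => hgen k hr
      | one => exact fun r hr => ⟨r, hr, by rw [Units.val_one, Matrix.vecMul_one]⟩
      | mul x y _ _ ihx ihy =>
        intro r hr
        obtain ⟨s, hs, hrs⟩ := ihx r hr
        obtain ⟨t, ht, hst⟩ := ihy s hs
        refine ⟨t, ht, ?_⟩
        rw [Units.val_mul, ← Matrix.vecMul_vecMul, perp_vecMul, hrs, ← perp_vecMul, hst]
    rintro _ ⟨w, hw, rfl⟩
    obtain ⟨h, hh, r, hr, rfl⟩ := (hR w).mp hw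
    obtain ⟨s, hs, hrs⟩ := key h hh r (seeds_subset r hr)
    exact ⟨⟨s, hs⟩, hrs.symm⟩
  · have hseeds (r : CycVec) (hr : r ∈ seeds) : perp (r.eval ζ) ∈ perp '' R :=
      ⟨_, (hR _).mpr ⟨1, one_mem _, r, hr, by rw [Units.val_one, Matrix.vecMul_one]⟩, rfl⟩
    have hdrop := of_isReachable (P := fun r => perp (r.eval ζ) ∈ perp '' R) ?_
      (fun r => List.mem_of_mem_drop) (fun r hr => ⟨seeds_subset r hr, hseeds r hr⟩)
      roots_reachable
    · rintro _ ⟨⟨r, hr⟩, rfl⟩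
      rw [roots_eq, List.mem_append] at hr
      exact hr.elim (hseeds r) (hdrop r)
    · rintro r hr s hs k h ⟨w, hw, hwr⟩
      obtain ⟨x, hx, a, ha, rfl⟩ := (hR w).mp hw
      refine ⟨_, (hR _).mpr ⟨x * g k, mul_mem hx (Subgroup.subset_closure ⟨k, rfl⟩), a, ha, rfl⟩,
        ?_⟩
      rw [Units.val_mul, ← Matrix.vecMul_vecMul, perp_vecMul, hwr, ← perp_vecMul, hg,
        perp_reflection hζ hr hs h]

end Orbit

end Arrgt

open Arrgt in
/-- Over `𝔽₂₅₁` the intersection lattice of the 27-hyperplane arrangement `𝓐` admits a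
realization which is free but not recursively free; hence `recursively free ⊊ free`
also holds in positive characteristic. -/
theorem F251_realization_free_not_recursivelyFree
    (ζ : ℂ) (hζ : IsPrimitiveRoot ζ 5)
    (g1 g2 g3 : GL (Fin 3) ℂ)
    (hg1 : (g1 : Matrix (Fin 3) (Fin 3) ℂ) = !![1, 0, 0; 0, 1, 1; 0, 0, -1])
    (hg2 : (g2 : Matrix (Fin 3) (Fin 3) ℂ) = !![-1, 0, 0; -ζ^2 - ζ^3, 1, 0; 0, 0, 1])
    (hg3 : (g3 : Matrix (Fin 3) (Fin 3) ℂ) = !![1, -ζ^2 - ζ^3, 0; 0, -1, 0; 0, 1, 1])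
    (W : Subgroup (GL (Fin 3) ℂ)) (hW : W = Subgroup.closure {g1, g2, g3})
    (R : Set (Fin 3 → ℂ))
    (hR : R = {w | ∃ g ∈ W, ∃ i : Fin 3,
          w = Matrix.vecMul (Pi.single i 1) (g : Matrix (Fin 3) (Fin 3) ℂ)} ∪
        {w | ∃ g ∈ W, w = Matrix.vecMul ![1, -ζ^2, 0] (g : Matrix (Fin 3) (Fin 3) ℂ)})
    (𝓐 : Set (Submodule ℂ (Fin 3 → ℂ))) (h𝓐 : 𝓐 = Arrgt.perp '' R)
    :
    ∃ C : Arrangement (ZMod 251) 3, C.hyperplanes.card = 27 ∧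
      Nonempty ((C.lattice : Set (Submodule (ZMod 251) (Fin 3 → ZMod 251))) ≃o
        (setLattice 𝓐 : Set (Submodule ℂ (Fin 3 → ℂ)))) ∧
      IsFree C ∧ ¬ RecursivelyFree (ZMod 251) C := by
  have hseed : seeds.map (CycVec.eval ζ) =
      [Pi.single 0 1, Pi.single 1 1, Pi.single 2 1, ![1, -ζ ^ 2, 0]] := by
    simp only [seeds, List.map_cons, List.map_nil, List.cons.injEq, and_true]
    refine ⟨?_, ?_, ?_, ?_⟩ <;> funext j <;> fin_cases j <;> simp [CycVec.eval, Cyc.eval]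
  have hmem (w : Fin 3 → ℂ) : (∃ r ∈ seeds, r.eval ζ = w) ↔
      (∃ i : Fin 3, w = Pi.single i 1) ∨ w = ![1, -ζ ^ 2, 0] := by
    rw [← List.mem_map, hseed]
    simp [Fin.exists_fin_succ, or_assoc]
  have hplanes : 𝓐 = rootPlanes ζ := by
    rw [h𝓐]
    refine image_perp_orbit hζ (g := ![g1, g2, g3]) ?_ fun w => ?_
    · intro k
      fin_cases k
      exacts [hg1, hg2, hg3]
    · have hrange : Set.range ![g1, g2, g3] = {g1, g2, g3} := by
        ext x
        simp [eq_comm]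
        tauto
      rw [hrange, ← hW, hR]
      constructor
      · rintro (⟨h, hh, i, rfl⟩ | ⟨h, hh, rfl⟩)
        · obtain ⟨r, hr, hri⟩ := (hmem _).mpr (Or.inl ⟨i, rfl⟩)
          exact ⟨h, hh, r, hr, by rw [hri]⟩
        · obtain ⟨r, hr, hri⟩ := (hmem _).mpr (Or.inr rfl)
          exact ⟨h, hh, r, hr, by rw [hri]⟩
      · rintro ⟨h, hh, r, hr, rfl⟩
        rcases (hmem _).mp ⟨r, hr, rfl⟩ with ⟨i, hi⟩ | hi
        · exact Or.inl ⟨h, hh, i, by rw [hi]⟩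
        · exact Or.inr ⟨h, hh, by rw [hi]⟩
  rw [hplanes]
  exact ⟨realization, card_realization, lattice_realization hζ, isFree_realization,
    not_recursivelyFree_realization⟩
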